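/- arXiv:1103.3423 — 2 statements merged into one kernel-verified Lean document; each statement's English description precedes it below -/
import Mathlib

section
/- Fix integers k ≥ 1 and n ≥ 2k+1, and fix ε > 0. There exist a constant L(ε,k,n), a constant c(n,ε) > 0, and a sequence of finite k-dimensional simplicial complexes X_i such that: (i) each vertex of each X_i belongs to at most L(ε,k,n) faces; (ii) the number N_i of faces of X_i tends to infinity; and (iii) for every i, every topological embedding I of |X_i| into ℝⁿ with combinatorial thickness at least 1 has the property that the Lebesgue measure of the open 1-neighborhood of I(|X_i|) is at least c(n,ε)·N_i^{n/(n−k) − ε}. -/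
open scoped Classical
open Metric Set Function MeasureTheory Filter

/-- An embedding `I` of the polyhedron of a geometric simplicial complex `X` has
combinatorial thickness at least `T` if the images of the convex hulls of any two
disjoint faces are at Euclidean distance at least `T` from each other. -/
def HasCombThickness {E F : Type*} [NormedAddCommGroup E] [NormedSpace ℝ E]
    [NormedAddCommGroup F] [NormedSpace ℝ F]
    (X : Geometry.SimplicialComplex ℝ E) (I : X.space → F) (T : ℝ) : Prop :=
  ∀ s ∈ X.faces, ∀ t ∈ X.faces, Disjoint s t →
    ∀ x y : X.space, (x : E) ∈ convexHull ℝ (s : Set E) →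
      (y : E) ∈ convexHull ℝ (t : Set E) → T ≤ dist (I x) (I y)


namespace GG

/-- chains: formal mod 2 combinations of lists -/
abbrev Ch (V : Type*) := List V →₀ ZMod 2

noncomputable def cone {V : Type*} (v : V) : Ch V →ₗ[ZMod 2] Ch V :=
  Finsupp.lmapDomain (ZMod 2) (ZMod 2) (List.cons v)

noncomputable def bdL {V : Type*} : List V → Ch V
  | [] => 0
  | v :: s => Finsupp.single s 1 + cone v (bdL s)

noncomputable def bd {V : Type*} : Ch V →ₗ[ZMod 2] Ch V :=
  Finsupp.linearCombination (ZMod 2) bdL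

noncomputable def mp {V W : Type*} (f : V → W) : Ch V →ₗ[ZMod 2] Ch W :=
  Finsupp.lmapDomain (ZMod 2) (ZMod 2) (List.map f)

@[simp] lemma cone_single {V : Type*} (v : V) (l : List V) (a : ZMod 2) :
    cone v (Finsupp.single l a) = Finsupp.single (v :: l) a := by
  simp [cone]

@[simp] lemma mp_single {V W : Type*} (f : V → W) (l : List V) (a : ZMod 2) :
    mp f (Finsupp.single l a) = Finsupp.single (l.map f) a := by
  simp [mp]

lemma bd_single {V : Type*} (l : List V) : bd (Finsupp.single l 1) = bdL l := by
  simp [bd]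

lemma bd_cone {V : Type*} (v : V) (c : Ch V) : bd (cone v c) = c + cone v (bd c) := by
  suffices h : bd ∘ₗ cone v = LinearMap.id + cone v ∘ₗ bd by
    exact LinearMap.congr_fun h c
  apply Finsupp.lhom_ext'
  intro l
  ext1
  simp [bd_single, bdL]

lemma single_cons {V : Type*} (v : V) (l : List V) :
    (Finsupp.single (v :: l) 1 : Ch V) = cone v (Finsupp.single l 1) := by simp

lemma bd_nil {V : Type*} : bd (Finsupp.single ([] : List V) 1) = 0 := by
  simp [bd_single, bdL]

/-- Induction principle for equality of linear maps on chains. -/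
lemma ch_ext {V M : Type*} [AddCommGroup M] [Module (ZMod 2) M] {f g : Ch V →ₗ[ZMod 2] M}
    (h : ∀ l, f (Finsupp.single l 1) = g (Finsupp.single l 1)) : f = g := by
  apply Finsupp.lhom_ext'
  intro l
  ext1
  simpa using h l

lemma bd_bd {V : Type*} (c : Ch V) : bd (bd c) = 0 := by
  suffices h : bd ∘ₗ bd = (0 : Ch V →ₗ[ZMod 2] Ch V) by
    exact LinearMap.congr_fun h c
  apply ch_ext
  intro l
  induction l with
  | nil => simp [bd_nil]
  | cons v l ih =>
    simp only [LinearMap.comp_apply, LinearMap.zero_apply] at ih ⊢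
    rw [single_cons, bd_cone, map_add, bd_cone, ih, map_zero, add_zero, ZModModule.add_self]

lemma mp_cone {V W : Type*} (f : V → W) (v : V) (c : Ch V) :
    mp f (cone v c) = cone (f v) (mp f c) := by
  suffices h : mp f ∘ₗ cone v = cone (f v) ∘ₗ mp f by
    exact LinearMap.congr_fun h c
  apply ch_ext
  intro l
  simp

lemma mp_bd {V W : Type*} (f : V → W) (c : Ch V) : mp f (bd c) = bd (mp f c) := by
  suffices h : mp f ∘ₗ bd = bd ∘ₗ mp f by
    exact LinearMap.congr_fun h c
  apply ch_ext
  intro l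
  induction l with
  | nil => simp [bd_nil]
  | cons v l ih =>
    simp only [LinearMap.comp_apply] at ih ⊢
    rw [single_cons, bd_cone, map_add, mp_cone, ih, mp_cone, bd_cone]

lemma mp_id {V : Type*} (c : Ch V) : mp (fun x : V => x) c = c := by
  simp [mp]

noncomputable def prL {V : Type*} (h h' : V → V) : List V → Ch V
  | [] => 0
  | v :: s => Finsupp.single (h v :: h' v :: s.map h') 1 + cone (h v) (prL h h' s)

noncomputable def pr {V : Type*} (h h' : V → V) : Ch V →ₗ[ZMod 2] Ch V :=
  Finsupp.linearCombination (ZMod 2) (prL h h')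

lemma pr_single {V : Type*} (h h' : V → V) (l : List V) :
    pr h h' (Finsupp.single l 1) = prL h h' l := by
  simp [pr]

lemma pr_cone {V : Type*} (h h' : V → V) (v : V) (c : Ch V) :
    pr h h' (cone v c) = cone (h v) (cone (h' v) (mp h' c)) + cone (h v) (pr h h' c) := by
  suffices H : pr h h' ∘ₗ cone v =
      cone (h v) ∘ₗ cone (h' v) ∘ₗ mp h' + cone (h v) ∘ₗ pr h h' by
    exact LinearMap.congr_fun H c
  apply ch_ext
  intro l
  simp [pr_single, prL]

lemma pr_homotopy {V : Type*} (h h' : V → V) (c : Ch V) :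
    bd (pr h h' c) + pr h h' (bd c) = mp h c + mp h' c := by
  suffices H : bd ∘ₗ pr h h' + pr h h' ∘ₗ bd = mp h + mp h' by
    exact LinearMap.congr_fun H c
  apply ch_ext
  intro l
  induction l with
  | nil => simp [bd_nil, pr_single, prL, ZModModule.add_self]
  | cons v l ih =>
    simp only [LinearMap.comp_apply, LinearMap.add_apply] at ih ⊢
    rw [single_cons]
    generalize (Finsupp.single l 1 : Ch V) = x at *
    rw [pr_cone, bd_cone, map_add, map_add, pr_cone, bd_cone, bd_cone, bd_cone, mp_cone, mp_cone,
      ← mp_bd]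
    have ih' : cone (h v) (bd (pr h h' x)) + cone (h v) (pr h h' (bd x)) =
        cone (h v) (mp h x) + cone (h v) (mp h' x) := by
      rw [← map_add, ih, map_add]
    simp only [map_add]
    have e1 := ZModModule.add_self (cone (h v) ((cone (h' v)) (mp h' (bd x))))
    have e2 := ZModModule.add_self (pr h h' x)
    have e3 := ZModModule.add_self (cone (h v) (mp h' x))
    have e4 : ∀ a b c d e f g i : Ch V, a + a = 0 → b + b = 0 → c + c = 0 → d + e = f + c →
      g + (c + a) + (b + d) + (b + (a + e)) = f + g := by
      intro a b c d e f g i h1 h2 h3 h4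
      calc _ = (a + a) + (b + b) + c + g + (d + e) := by abel
        _ = (c + c) + (f + g) := by rw [h1, h2, h4]; abel
        _ = _ := by rw [h3, zero_add]
    have := e4 _ _ _ _ _ _ (cone (h' v) (mp h' x)) 0 e1 e2 e3 ih'
    rw [← this]

noncomputable def contr {V : Type*} (h : ℕ → V → V) (T : ℕ) (z : V) : Ch V →ₗ[ZMod 2] Ch V :=
  ∑ t ∈ Finset.range T, pr (h t) (h (t + 1)) + cone z ∘ₗ mp (h T)

lemma contr_homotopy {V : Type*} (h : ℕ → V → V) (T : ℕ) (z : V) (h0 : ∀ x, h 0 x = x)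
    (c : Ch V) : bd (contr h T z c) + contr h T z (bd c) = c := by
  have key : ∀ T, bd ((∑ t ∈ Finset.range T, pr (h t) (h (t + 1))) c) +
      (∑ t ∈ Finset.range T, pr (h t) (h (t + 1))) (bd c) = c + mp (h T) c := by
    intro T
    induction T with
    | zero =>
      have : h 0 = fun x => x := funext h0
      rw [this, mp_id]; simp [ZModModule.add_self]
    | succ T ih =>
      rw [Finset.sum_range_succ, LinearMap.add_apply, LinearMap.add_apply, map_add]
      have := pr_homotopy (h T) (h (T+1)) c
      have e := ZModModule.add_self (mp (h T) c)
      calc _ = (bd ((∑ t ∈ Finset.range T, pr (h t) (h (t + 1))) c) +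
      (∑ t ∈ Finset.range T, pr (h t) (h (t + 1))) (bd c)) + (bd ((pr (h T) (h (T + 1))) c) + (pr (h T) (h (T + 1))) (bd c)) := by abel
        _ = c + (mp (h T) c + mp (h T) c) + mp (h (T+1)) c := by rw [ih, this]; abel
        _ = _ := by rw [e, add_zero]
  have := key T
  simp only [contr, LinearMap.add_apply, map_add, LinearMap.comp_apply]
  rw [bd_cone, mp_bd]
  have e := ZModModule.add_self (mp (h T) c)
  have e' := ZModModule.add_self (cone z (bd (mp (h T) c)))
  calc _ = (bd ((∑ t ∈ Finset.range T, pr (h t) (h (t + 1))) c) +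
      (∑ t ∈ Finset.range T, pr (h t) (h (t + 1))) (bd c)) + mp (h T) c + ((cone z (bd (mp (h T) c))) + (cone z (bd (mp (h T) c)))) := by abel
    _ = c + (mp (h T) c + mp (h T) c) := by rw [this, e']; abel
    _ = c := by rw [e, add_zero]

/-- chains supported on a set of lists -/
abbrev Sp {V : Type*} (p : List V → Prop) : Submodule (ZMod 2) (Ch V) :=
  Finsupp.supported (ZMod 2) (ZMod 2) {l | p l}

lemma Sp_single {V : Type*} {p : List V → Prop} {l : List V} (h : p l) (a : ZMod 2) :
    Finsupp.single l a ∈ Sp p := Finsupp.single_mem_supported _ _ h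

lemma Sp_mem {V : Type*} {p : List V → Prop} {c : Ch V} (h : c ∈ Sp p) {l : List V}
    (hl : c l ≠ 0) : p l := by
  have := (Finsupp.mem_supported _ _).1 h
  exact this (by simpa using hl)

lemma Sp_mono {V : Type*} {p p' : List V → Prop} (h : ∀ l, p l → p' l) : Sp p ≤ Sp p' :=
  Finsupp.supported_mono h

lemma Sp_map {V M : Type*} [AddCommGroup M] [Module (ZMod 2) M] {p : List V → Prop}
    (f : Ch V →ₗ[ZMod 2] M) (S : Submodule (ZMod 2) M)
    (h : ∀ l, p l → f (Finsupp.single l 1) ∈ S) {c : Ch V} (hc : c ∈ Sp p) : f c ∈ S := by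
  rw [Sp, Finsupp.supported_eq_span_single] at hc
  have : Submodule.span (ZMod 2) ((fun i => Finsupp.single i (1 : ZMod 2)) '' {l | p l}) ≤
      S.comap f := by
    rw [Submodule.span_le]
    rintro _ ⟨l, hl, rfl⟩
    exact h l hl
  exact this hc

lemma Sp_eq {V M : Type*} [AddCommGroup M] [Module (ZMod 2) M] {p : List V → Prop}
    (f g : Ch V →ₗ[ZMod 2] M)
    (h : ∀ l, p l → f (Finsupp.single l 1) = g (Finsupp.single l 1)) {c : Ch V} (hc : c ∈ Sp p) :
    f c = g c := by
  have := Sp_map (f - g) ⊥ (p := p) (by intro l hl; simp [h l hl]) hc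
  simpa [sub_eq_zero] using this

lemma bd_supp {V : Type*} (l : List V) :
    bd (Finsupp.single l 1) ∈ Sp (fun l' => l'.Sublist l ∧ l'.length + 1 = l.length) := by
  induction l with
  | nil => simp [bd_nil]
  | cons v l ih =>
    rw [single_cons, bd_cone]
    refine Submodule.add_mem _ (Sp_single ?_ _) (Sp_map _ _ ?_ ih)
    · simp
    · intro l' hl'
      rw [cone_single]
      exact Sp_single ⟨hl'.1.cons_cons v, by simp [hl'.2]⟩ _

lemma pr_supp {V : Type*} (h h' : V → V) (l : List V) :
    pr h h' (Finsupp.single l 1) ∈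
      Sp (fun l' => l'.length = l.length + 1 ∧ ∀ y ∈ l', ∃ x ∈ l, y = h x ∨ y = h' x) := by
  induction l with
  | nil => simp [pr_single, prL]
  | cons v l ih =>
    rw [single_cons, pr_cone]
    refine Submodule.add_mem _ ?_ (Sp_map _ _ ?_ ih)
    · simp only [mp_single, cone_single]
      refine Sp_single ⟨by simp, ?_⟩ _
      intro y hy
      simp only [List.mem_cons, List.mem_map] at hy ⊢
      rcases hy with rfl | rfl | ⟨a, ha, rfl⟩
      · exact ⟨v, Or.inl rfl, Or.inl rfl⟩
      · exact ⟨v, Or.inl rfl, Or.inr rfl⟩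
      · exact ⟨a, Or.inr ha, Or.inr rfl⟩
    · intro l' hl'
      rw [cone_single]
      refine Sp_single ⟨by simp [hl'.1], ?_⟩ _
      intro y hy
      simp only [List.mem_cons] at hy ⊢
      rcases hy with rfl | hy
      · exact ⟨v, Or.inl rfl, Or.inl rfl⟩
      · obtain ⟨x, hx, hxy⟩ := hl'.2 y hy
        exact ⟨x, Or.inr hx, hxy⟩

lemma contr_supp {V : Type*} (h : ℕ → V → V) (T : ℕ) (z : V) (hT : ∀ t, T ≤ t → ∀ x, h t x = z)
    (l : List V) (hl : l ≠ []) :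
    contr h T z (Finsupp.single l 1) ∈
      Sp (fun l' => l'.length = l.length + 1 ∧
        ∃ t ≤ T, ∀ y ∈ l', ∃ x ∈ l, y = h t x ∨ y = h (t + 1) x) := by
  rw [contr, LinearMap.add_apply]
  refine Submodule.add_mem _ ?_ ?_
  · rw [LinearMap.sum_apply]
    refine Submodule.sum_mem _ ?_
    intro t ht
    refine Sp_mono ?_ (pr_supp (h t) (h (t+1)) l)
    intro l' hl'
    exact ⟨hl'.1, t, (Finset.mem_range.1 ht).le, hl'.2⟩
  · rw [LinearMap.comp_apply, mp_single, cone_single]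
    refine Sp_single ⟨by simp, T, le_rfl, ?_⟩ _
    intro y hy
    obtain ⟨x, hx⟩ := List.exists_mem_of_ne_nil l hl
    refine ⟨x, hx, Or.inl ?_⟩
    simp only [List.mem_cons, List.mem_map] at hy
    rcases hy with rfl | ⟨a, ha, rfl⟩
    · rw [hT T le_rfl]
    · rw [hT T le_rfl, hT T le_rfl]

lemma contr_nil {V : Type*} (h : ℕ → V → V) (T : ℕ) (z : V) :
    contr h T z (Finsupp.single [] 1) = Finsupp.single [z] 1 := by
  rw [contr, LinearMap.add_apply, LinearMap.sum_apply]
  simp [pr_single, prL]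

/-! Finset chains -/

noncomputable def wdF {Λ : Type*} (b : Λ) (e : Finset Λ) : Finset Λ →₀ ZMod 2 :=
  if b ∈ e then 0 else Finsupp.single (insert b e) 1

noncomputable def wd {Λ : Type*} (b : Λ) : (Finset Λ →₀ ZMod 2) →ₗ[ZMod 2] (Finset Λ →₀ ZMod 2) :=
  Finsupp.linearCombination (ZMod 2) (wdF b)

noncomputable def fbd {Λ : Type*} : (Finset Λ →₀ ZMod 2) →ₗ[ZMod 2] (Finset Λ →₀ ZMod 2) :=
  Finsupp.linearCombination (ZMod 2) (fun e => ∑ b ∈ e, Finsupp.single (e.erase b) 1)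

lemma fbd_wd {Λ : Type*} (b : Λ) (c : Finset Λ →₀ ZMod 2) :
    fbd (wd b c) = c + wd b (fbd c) := by
  suffices H : fbd ∘ₗ wd b = LinearMap.id + wd b ∘ₗ fbd by
    exact LinearMap.congr_fun H c
  apply Finsupp.lhom_ext'
  intro e
  ext1
  simp only [LinearMap.comp_apply, LinearMap.add_apply, Finsupp.lsingle_apply, LinearMap.id_apply,
    wd, fbd, Finsupp.linearCombination_single, one_smul, wdF, map_sum]
  by_cases hb : b ∈ e
  · rw [if_pos hb, map_zero, Finset.sum_eq_single b]
    · rw [if_neg (by simp), Finset.insert_erase hb, ZModModule.add_self]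
    · intro c hc hcb
      rw [if_pos]
      simp [hb, Ne.symm hcb]
    · exact fun h => absurd hb h
  · rw [if_neg hb, Finsupp.linearCombination_single, one_smul, Finset.sum_insert hb,
      Finset.erase_insert hb]
    congr 1
    apply Finset.sum_congr rfl
    intro c hc
    have hcb : b ≠ c := fun h => hb (h ▸ hc)
    rw [if_neg (by simp [hb]), Finset.erase_insert_of_ne hcb]

noncomputable def pjL {Λ : Type*} : List Λ → (Finset Λ →₀ ZMod 2)
  | [] => Finsupp.single ∅ 1
  | b :: l => wd b (pjL l)

noncomputable def pj {Λ : Type*} : Ch Λ →ₗ[ZMod 2] (Finset Λ →₀ ZMod 2) :=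
  Finsupp.linearCombination (ZMod 2) pjL

lemma pj_cone {Λ : Type*} (b : Λ) (c : Ch Λ) : pj (cone b c) = wd b (pj c) := by
  suffices H : pj ∘ₗ cone b = wd b ∘ₗ pj by
    exact LinearMap.congr_fun H c
  apply ch_ext
  intro l
  simp [pj, pjL]

lemma pj_bd {Λ : Type*} (c : Ch Λ) : pj (bd c) = fbd (pj c) := by
  suffices H : pj ∘ₗ bd = fbd ∘ₗ pj by
    exact LinearMap.congr_fun H c
  apply ch_ext
  intro l
  induction l with
  | nil => simp [bd_nil, pj, pjL, fbd]
  | cons v l ih =>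
    simp only [LinearMap.comp_apply] at ih ⊢
    rw [single_cons, bd_cone, map_add, pj_cone, ih, pj_cone, fbd_wd]

lemma pj_supp {Λ : Type*} (l : List Λ) (e : Finset Λ) (h : pj (Finsupp.single l 1) e ≠ 0) :
    e = l.toFinset ∧ e.card = l.length := by
  have : pj (Finsupp.single l 1) ∈ Finsupp.supported (ZMod 2) (ZMod 2)
      {e : Finset Λ | e = l.toFinset ∧ e.card = l.length} := by
    clear h
    induction l with
    | nil =>
      simp only [pj, Finsupp.linearCombination_single, one_smul, pjL]
      exact Finsupp.single_mem_supported _ _ (by simp)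
    | cons b l ih =>
      rw [single_cons, pj_cone]
      rw [Finsupp.supported_eq_span_single] at ih
      have h2 : Submodule.span (ZMod 2) ((fun i => Finsupp.single i (1 : ZMod 2)) ''
        {e : Finset Λ | e = l.toFinset ∧ e.card = l.length}) ≤ (Finsupp.supported (ZMod 2) (ZMod 2)
        {e : Finset Λ | e = (b :: l).toFinset ∧ e.card = (b :: l).length}).comap (wd b) := by
        rw [Submodule.span_le]
        rintro _ ⟨e, ⟨he, hc⟩, rfl⟩
        simp only [SetLike.mem_coe, Submodule.mem_comap, wd, Finsupp.linearCombination_single, one_smul, wdF]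
        split_ifs with hb
        · exact Submodule.zero_mem _
        · refine Finsupp.single_mem_supported _ _ ⟨?_, ?_⟩
          · rw [he]; ext; simp
          · rw [Finset.card_insert_of_notMem hb, hc]; simp
      exact h2 ih
  have h3 := (Finsupp.mem_supported _ _).1 this
  exact h3 (by simpa using h)

lemma fbd_apply {Λ : Type*} (c : Finset Λ →₀ ZMod 2) (e : Finset Λ) (B : Finset Λ)
    (hB : ∀ e', c e' ≠ 0 → e' ⊆ B) :
    fbd c e = ∑ b ∈ B \ e, c (insert b e) := by
  have h1 : fbd c e = ∑ e' ∈ c.support, c e' * (∑ b ∈ e', if e'.erase b = e then 1 else 0) := by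
    rw [fbd, Finsupp.linearCombination_apply, Finsupp.sum, Finsupp.finsetSum_apply]
    apply Finset.sum_congr rfl
    intro e' _
    rw [Finsupp.smul_apply, Finsupp.finsetSum_apply, smul_eq_mul]
    congr 1
    apply Finset.sum_congr rfl
    intro b _
    rw [Finsupp.single_apply]
  rw [h1]
  have h2 : ∀ e' ∈ c.support, c e' * (∑ b ∈ e', if e'.erase b = e then (1 : ZMod 2) else 0) =
      ∑ b ∈ B \ e, if insert b e = e' then c e' else 0 := by
    intro e' he'
    have hs := hB e' (by simpa using he')
    rw [Finset.mul_sum]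
    simp only [mul_ite, mul_one, mul_zero]
    rw [← Finset.sum_filter, ← Finset.sum_filter]
    congr 1
    ext b
    simp only [Finset.mem_filter, Finset.mem_sdiff]
    constructor
    · rintro ⟨h, rfl⟩
      exact ⟨⟨hs h, by simp⟩, Finset.insert_erase h⟩
    · rintro ⟨⟨h, h'⟩, rfl⟩
      exact ⟨by simp, Finset.erase_insert h'⟩
  rw [Finset.sum_congr rfl h2, Finset.sum_comm]
  apply Finset.sum_congr rfl
  intro b _
  rw [Finset.sum_ite_eq]
  split_ifs with h
  · rfl
  · exact (Finsupp.notMem_support_iff.1 h).symm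
end GG


namespace GG

noncomputable def lst {V : Type*} (A : Finset V) : ℕ → Finset (List V)
  | 0 => {[]}
  | j + 1 => (A ×ˢ lst A j).image (fun p => p.1 :: p.2)

lemma mem_lst {V : Type*} (A : Finset V) (j : ℕ) (l : List V) :
    l ∈ lst A j ↔ l.length = j ∧ ∀ x ∈ l, x ∈ A := by
  induction j generalizing l with
  | zero => 
    simp only [lst, Finset.mem_singleton, List.length_eq_zero_iff]
    constructor
    · rintro rfl; simp
    · exact fun h => h.1
  | succ j ih =>
    simp only [lst, Finset.mem_image, Finset.mem_product, Prod.exists]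
    constructor
    · rintro ⟨a, b, ⟨ha, hb⟩, rfl⟩
      rw [ih] at hb
      simp [hb.1, ha]
      exact hb.2
    · rintro ⟨h1, h2⟩
      cases l with
      | nil => simp at h1
      | cons a b =>
        refine ⟨a, b, ⟨h2 a (by simp), ?_⟩, rfl⟩
        rw [ih]
        exact ⟨by simpa using h1, fun x hx => h2 x (by simp [hx])⟩

lemma card_lst {V : Type*} (A : Finset V) (j : ℕ) : (lst A j).card ≤ A.card ^ j := by
  induction j with
  | zero => simp [lst]
  | succ j ih =>
    calc _ ≤ (A ×ˢ lst A j).card := Finset.card_image_le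
      _ = A.card * (lst A j).card := Finset.card_product _ _
      _ ≤ A.card * A.card ^ j := Nat.mul_le_mul_left _ ih
      _ = _ := by ring

abbrev Gr (m q : ℕ) := Fin m → Fin q

def adj {m q : ℕ} (x y : Gr m q) : Prop := ∀ i, (x i : ℕ) ≤ y i + 1 ∧ (y i : ℕ) ≤ x i + 1

def Clq {m q : ℕ} (l : List (Gr m q)) : Prop := ∀ x ∈ l, ∀ y ∈ l, adj x y

noncomputable def G (m q j : ℕ) : Finset (List (Gr m q)) := (lst Finset.univ j).filter Clq

lemma mem_G {m q j : ℕ} (l : List (Gr m q)) : l ∈ G m q j ↔ l.length = j ∧ Clq l := by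
  simp [G, mem_lst]

noncomputable def nb {m q : ℕ} (x : Gr m q) : Finset (Gr m q) := Finset.univ.filter (adj x)

lemma card_nb {m q : ℕ} (x : Gr m q) : (nb x).card ≤ 3 ^ m := by
  have h1 : nb x ⊆ Fintype.piFinset (fun i => Finset.univ.filter
      (fun v : Fin q => (x i : ℕ) ≤ v + 1 ∧ (v : ℕ) ≤ x i + 1)) := by
    intro y hy
    simp only [nb, Finset.mem_filter, Finset.mem_univ, true_and] at hy
    simp only [Fintype.mem_piFinset, Finset.mem_filter, Finset.mem_univ, true_and]
    exact hy
  refine (Finset.card_le_card h1).trans ?_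
  rw [Fintype.card_piFinset]
  have : ∀ i ∈ (Finset.univ : Finset (Fin m)), (Finset.univ.filter
      (fun v : Fin q => (x i : ℕ) ≤ v + 1 ∧ (v : ℕ) ≤ x i + 1)).card ≤ 3 := by
    intro i _
    calc _ = ((Finset.univ.filter
      (fun v : Fin q => (x i : ℕ) ≤ v + 1 ∧ (v : ℕ) ≤ x i + 1)).image (fun v : Fin q => (v : ℕ))).card :=
          (Finset.card_image_of_injective _ Fin.val_injective).symm
      _ ≤ (Finset.Icc ((x i : ℕ) - 1) (x i + 1)).card := by
        apply Finset.card_le_card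
        intro v hv
        simp only [Finset.mem_image, Finset.mem_filter, Finset.mem_univ, true_and] at hv
        obtain ⟨w, hw, rfl⟩ := hv
        rw [Finset.mem_Icc]; omega
      _ ≤ 3 := by simp; omega
  refine (Finset.prod_le_prod' this).trans ?_
  simp

def cl (s z x : ℕ) : ℕ := max (z - s) (min x (z + s))

def hh {m q : ℕ} (z : Gr m q) (t : ℕ) (x : Gr m q) : Gr m q := fun i =>
  ⟨cl (q - t) (z i) (x i), by
    have := (z i).2; have := (x i).2; simp only [cl]; omega⟩

lemma hh_zero {m q : ℕ} (z x : Gr m q) : hh z 0 x = x := by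
  ext i
  have := (z i).2; have := (x i).2
  simp only [hh, cl]; omega

lemma hh_top {m q : ℕ} (z x : Gr m q) (t : ℕ) (ht : q ≤ t) : hh z t x = z := by
  ext i
  simp only [hh, cl]; omega

lemma hh_adj {m q : ℕ} (z x y : Gr m q) (t t' : ℕ) (h : adj x y) (ht : t' ≤ t + 1) (ht' : t ≤ t' + 1) :
    adj (hh z t x) (hh z t' y) := by
  intro i
  have := h i
  simp only [hh, cl]; omega

lemma hh_count {m q : ℕ} (t : ℕ) (y : Gr m q) :
    (Finset.univ.filter (fun p : Gr m q × Gr m q => hh p.1 t p.2 = y)).card ≤ (3 * q) ^ m := by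
  let S : Fin m → Finset (Fin q × Fin q) := fun i =>
    Finset.univ.filter (fun p => cl (q - t) p.1 p.2 = y i)
  have h1 : (Finset.univ.filter (fun p : Gr m q × Gr m q => hh p.1 t p.2 = y)).card ≤
      (Fintype.piFinset S).card := by
    apply Finset.card_le_card_of_injOn (fun p i => (p.1 i, p.2 i))
    · intro p hp
      simp only [Finset.coe_filter, Finset.mem_univ, true_and, Set.mem_ofPred_eq] at hp
      simp only [Finset.mem_coe, Fintype.mem_piFinset, S, Finset.mem_filter, Finset.mem_univ, true_and]
      intro i
      rw [← hp]; rfl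
    · intro p _ p' _ h
      ext i
      · have := congrFun h i; simp at this; rw [this.1]
      · have := congrFun h i; simp at this; rw [this.2]
  refine h1.trans ?_
  rw [Fintype.card_piFinset]
  have : ∀ i ∈ (Finset.univ : Finset (Fin m)), (S i).card ≤ 3 * q := by
    intro i _
    let A : Finset (ℕ × ℕ) := ({(y i : ℕ) + (q - t)} ×ˢ Finset.range q) ∪
      ({(y i : ℕ) - (q - t)} ×ˢ Finset.range q) ∪ (Finset.range q ×ˢ {(y i : ℕ)})
    calc (S i).card ≤ A.card := by
          apply Finset.card_le_card_of_injOn (fun p => ((p.1 : ℕ), (p.2 : ℕ)))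
          · intro p hp
            have h1 := p.1.2
            have h2 := p.2.2
            have hp := (Finset.mem_filter.1 (Finset.mem_coe.1 hp)).2
            simp only [cl] at hp
            simp only [A, Finset.mem_coe, Finset.mem_union, Finset.mem_product,
              Finset.mem_singleton, Finset.mem_range]
            omega
          · intro p _ p' _ h
            simp only [Prod.mk.injEq] at h
            ext
            · exact h.1
            · exact h.2
      _ ≤ q + q + q := by
          refine (Finset.card_union_le _ _).trans ?_
          refine add_le_add ((Finset.card_union_le _ _).trans ?_) ?_ <;> simp
      _ = 3 * q := by ring
  refine (Finset.prod_le_prod' this).trans ?_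
  simp

abbrev Dl (V : Type*) := Ch V →ₗ[ZMod 2] ZMod 2

noncomputable def sz {m q : ℕ} (j : ℕ) (α : Dl (Gr m q)) : ℕ :=
  ((G m q j).filter (fun l => α (Finsupp.single l 1) ≠ 0)).card

lemma exists_ne {V : Type*} (α : Dl V) {p : List V → Prop} {c : Ch V} (hc : c ∈ Sp p)
    (h : α c ≠ 0) : ∃ l, p l ∧ α (Finsupp.single l 1) ≠ 0 := by
  by_contra! H
  apply h
  exact Sp_eq α 0 (fun l hl => H l hl) hc

lemma contr_good {m q j : ℕ} (z : Gr m q) (l : List (Gr m q)) (hl : l ∈ G m q (j+1)) :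
    contr (hh z) q z (Finsupp.single l 1) ∈ Sp (fun l' => l' ∈ G m q (j + 2) ∧
      ∃ t ≤ q, ∀ y ∈ l', ∃ x ∈ l, y = hh z t x ∨ y = hh z (t+1) x) := by
  rw [mem_G] at hl
  have hne : l ≠ [] := by rintro rfl; simp at hl
  refine Sp_mono ?_ (contr_supp (hh z) q z (fun t ht x => hh_top z x t ht) l hne)
  rintro l' ⟨h1, t, ht, h2⟩
  refine ⟨?_, t, ht, h2⟩
  rw [mem_G]
  refine ⟨by omega, ?_⟩
  intro a ha b hb
  obtain ⟨x, hx, hxa⟩ := h2 a ha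
  obtain ⟨y, hy, hyb⟩ := h2 b hb
  have hxy := hl.2 x hx y hy
  rcases hxa with rfl | rfl <;> rcases hyb with rfl | rfl <;> apply hh_adj _ _ _ _ _ hxy <;> omega

lemma cofill_eq {m q j : ℕ} (α : Dl (Gr m q)) (z : Gr m q)
    (hα : ∀ l ∈ G m q (j + 2), α (bd (Finsupp.single l 1)) = 0)
    (l : List (Gr m q)) (hl : l ∈ G m q (j+1)) :
    α (contr (hh z) q z (bd (Finsupp.single l 1))) = α (Finsupp.single l 1) := by
  have h1 := contr_homotopy (hh z) q z (hh_zero z) (Finsupp.single l 1)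
  have h2 : (α ∘ₗ bd) (contr (hh z) q z (Finsupp.single l 1)) = 0 := by
    exact Sp_eq (α ∘ₗ bd) 0 (fun l' h => hα l' h.1) (contr_good z l hl)
  conv_rhs => rw [← h1]
  rw [map_add]
  simp only [LinearMap.comp_apply] at h2
  rw [h2, zero_add]

lemma cofill_zero {m q : ℕ} (α : Dl (Gr m q)) 
    (hα : ∀ l ∈ G m q 2, α (bd (Finsupp.single l 1)) = 0) (hs : sz 1 α < q ^ m) 
    (l : List (Gr m q)) (hl : l ∈ G m q 1) : α (Finsupp.single l 1) = 0 := by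
  have hz : ∃ z : Gr m q, α (Finsupp.single [z] 1) = 0 := by
    by_contra! H
    have : (Finset.univ : Finset (Gr m q)).card ≤ sz 1 α := by
      apply Finset.card_le_card_of_injOn (fun z => [z])
      · intro z _
        simp only [Finset.coe_filter, Set.mem_ofPred_eq, mem_G]
        refine ⟨⟨rfl, ?_⟩, H z⟩
        intro a ha b hb
        simp only [List.mem_singleton] at ha hb
        subst ha; subst hb
        intro i; omega
      · intro a _ b _ h; simpa using h
    simp at this
    omega
  obtain ⟨z, hz⟩ := hz
  rw [← cofill_eq α z hα l hl]
  obtain ⟨x, rfl⟩ := List.length_eq_one_iff.1 ((mem_G l).1 hl).1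
  rw [single_cons, bd_cone, bd_nil, map_zero, add_zero, contr_nil, hz]

lemma congestion {m q j : ℕ} (hq : 0 < q) (τ : List (Gr m q)) (hτ : τ ∈ G m q (j + 2)) :
    ((Finset.univ ×ˢ G m q (j+1)).filter (fun p : Gr m q × List (Gr m q) =>
      ∃ t ≤ q, ∀ y ∈ τ, ∃ x ∈ p.2, y = hh p.1 t x ∨ y = hh p.1 (t+1) x)).card ≤
      (3 * q) * (3 * q) ^ m * (3 ^ m) ^ (j + 1) := by
  obtain ⟨y, hy⟩ : ∃ y, y ∈ τ := List.exists_mem_of_ne_nil τ (by rintro rfl; simp [mem_G] at hτ)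
  let A : Finset (Gr m q × List (Gr m q)) := (Finset.range (q + 2)).biUnion (fun t =>
    (Finset.univ.filter (fun p : Gr m q × Gr m q => hh p.1 t p.2 = y)).biUnion
      (fun p => {p.1} ×ˢ lst (nb p.2) (j+1)))
  calc _ ≤ A.card := by
        apply Finset.card_le_card
        rintro ⟨z, l⟩ hp
        simp only [Finset.mem_filter, Finset.mem_product, Finset.mem_univ, true_and] at hp
        obtain ⟨hl, t, ht, h⟩ := hp
        obtain ⟨x, hx, hxy⟩ := h y hy
        rw [mem_G] at hl
        have hl' : l ∈ lst (nb x) (j+1) := by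
          rw [mem_lst]
          refine ⟨hl.1, fun a ha => ?_⟩
          simp only [nb, Finset.mem_filter, Finset.mem_univ, true_and]
          exact hl.2 x hx a ha
        simp only [A, Finset.mem_biUnion, Finset.mem_range, Finset.mem_filter, Finset.mem_univ,
          true_and, Finset.mem_product, Finset.mem_singleton]
        rcases hxy with h | h
        · exact ⟨t, by omega, (z, x), h.symm, rfl, hl'⟩
        · exact ⟨t+1, by omega, (z, x), h.symm, rfl, hl'⟩
    _ ≤ (q + 2) * ((3 * q) ^ m * (3 ^ m) ^ (j + 1)) := by
        have h3 : ∀ t ∈ Finset.range (q+2), ((Finset.univ.filter (fun p : Gr m q × Gr m q => hh p.1 t p.2 = y)).biUnion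
      (fun p => ({p.1} : Finset (Gr m q)) ×ˢ lst (nb p.2) (j+1))).card ≤ (3 * q) ^ m * (3 ^ m) ^ (j + 1) := by
          intro t _
          refine (Finset.card_biUnion_le_card_mul _ _ ((3 ^ m) ^ (j + 1)) ?_).trans
            (Nat.mul_le_mul_right _ (hh_count t y))
          intro p _
          rw [Finset.card_product, Finset.card_singleton, one_mul]
          exact (card_lst _ _).trans (Nat.pow_le_pow_left (card_nb _) _)
        refine (Finset.card_biUnion_le_card_mul _ _ _ h3).trans ?_
        rw [Finset.card_range]
    _ ≤ (3 * q) * ((3 * q) ^ m * (3 ^ m) ^ (j + 1)) := Nat.mul_le_mul_right _ (by omega)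
    _ = _ := by ring

lemma cofill {m q j : ℕ} (hq : 0 < q) (α : Dl (Gr m q))
    (hα : ∀ l ∈ G m q (j + 3), α (bd (Finsupp.single l 1)) = 0) :
    ∃ β : Dl (Gr m q), (∀ l ∈ G m q (j+2), β (bd (Finsupp.single l 1)) = α (Finsupp.single l 1)) ∧
      sz (j+1) β ≤ ((3 * q) * 3 ^ m * (3 ^ m) ^ (j + 1)) * sz (j+2) α := by
  have key : ∑ z : Gr m q, sz (j+1) (α ∘ₗ contr (hh z) q z) ≤
      ∑ z : Gr m q, ((3 * q) * 3 ^ m * (3 ^ m) ^ (j + 1)) * sz (j+2) α := by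
    let A : Finset (Gr m q × List (Gr m q)) :=
      (((G m q (j+2)).filter (fun l => α (Finsupp.single l 1) ≠ 0))).biUnion (fun τ =>
       ((Finset.univ ×ˢ G m q (j+1)).filter (fun p : Gr m q × List (Gr m q) =>
      ∃ t ≤ q, ∀ y ∈ τ, ∃ x ∈ p.2, y = hh p.1 t x ∨ y = hh p.1 (t+1) x)))
    calc _ = (Finset.univ.sigma (fun z : Gr m q => ((G m q (j+1)).filter (fun l => (α ∘ₗ contr (hh z) q z) (Finsupp.single l 1) ≠ 0)))).card := by
            rw [Finset.card_sigma]; rfl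
      _ ≤ A.card := by
        apply Finset.card_le_card_of_injOn (fun p => (p.1, p.2))
        · rintro ⟨z, l⟩ hp
          simp only [Finset.coe_sigma, Finset.coe_univ, Set.mem_sigma_iff, Set.mem_univ, true_and,
            Finset.coe_filter, Set.mem_ofPred_eq, LinearMap.comp_apply] at hp
          obtain ⟨τ, ⟨h1, h2⟩, h3⟩ := exists_ne α (contr_good z l hp.1) hp.2
          simp only [A, Finset.mem_coe, Finset.mem_biUnion, Finset.mem_filter, Finset.mem_product,
            Finset.mem_univ, true_and]
          exact ⟨τ, ⟨h1, h3⟩, hp.1, h2⟩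
        · rintro ⟨z, l⟩ _ ⟨z', l'⟩ _ h
          simp only [Prod.mk.injEq] at h
          rw [h.1, h.2]
      _ ≤ sz (j+2) α * ((3 * q) * (3 * q) ^ m * (3 ^ m) ^ (j + 1)) := by
        apply Finset.card_biUnion_le_card_mul
        intro τ hτ
        exact congestion hq τ (Finset.mem_filter.1 hτ).1
      _ = _ := by
        rw [Finset.sum_const]
        simp only [Finset.card_univ, Fintype.card_pi, Fintype.card_fin, Finset.prod_const, smul_eq_mul]
        rw [mul_pow]; ring
  have hne : (Finset.univ : Finset (Gr m q)).Nonempty := ⟨fun _ => ⟨0, hq⟩, Finset.mem_univ _⟩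
  obtain ⟨z, _, hz⟩ := Finset.exists_le_of_sum_le hne key
  exact ⟨α ∘ₗ contr (hh z) q z, fun l hl => cofill_eq α z hα l hl, hz⟩

lemma sz_add {m q j : ℕ} (α β : Dl (Gr m q)) : sz j (α + β) ≤ sz j α + sz j β := by
  refine le_trans (Finset.card_le_card ?_) (Finset.card_union_le _ _)
  intro l hl
  simp only [Finset.mem_filter, Finset.mem_union, LinearMap.add_apply] at hl ⊢
  by_contra! H
  apply hl.2
  rw [H.1 hl.1, H.2 hl.1, add_zero]

lemma sz_sum {ι : Type*} {m q j : ℕ} (s : Finset ι) (f : ι → Dl (Gr m q)) :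
    sz j (∑ i ∈ s, f i) ≤ ∑ i ∈ s, sz j (f i) := by
  induction s using Finset.induction_on with
  | empty => simp [sz]
  | insert a s ha ih =>
    rw [Finset.sum_insert ha, Finset.sum_insert ha]
    exact (sz_add _ _).trans (by omega)

/-- double sums over ordered pairs vanish mod 2 -/
lemma double_sum {Λ M : Type*} [AddCommGroup M] [Module (ZMod 2) M] (B e : Finset Λ)
    (H : Finset Λ → M) :
    ∑ b ∈ B \ e, ∑ c ∈ B \ insert b e, H (insert c (insert b e)) = 0 := by
  rw [Finset.sum_sigma']
  apply Finset.sum_involution (fun p _ => ⟨p.2, p.1⟩)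
  · rintro ⟨b, c⟩ _
    simp only
    rw [Finset.insert_comm]
    exact ZModModule.add_self _
  · rintro ⟨b, c⟩ h _ h'
    simp only [Sigma.mk.injEq, heq_eq_eq] at h'
    simp [h'.1] at h
  · rintro ⟨b, c⟩ h
    rfl
  · rintro ⟨b, c⟩ h
    simp only [Finset.mem_sigma, Finset.mem_sdiff, Finset.mem_insert, not_or] at h ⊢
    tauto

end GG


namespace GG

noncomputable def th {Λ : Type*} {m q : ℕ} (Θ : Ch (Gr m q) →ₗ[ZMod 2] (Finset Λ →₀ ZMod 2))
    (e : Finset Λ) : Dl (Gr m q) := (Finsupp.lapply e) ∘ₗ Θ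

lemma th_apply {Λ : Type*} {m q : ℕ} (Θ : Ch (Gr m q) →ₗ[ZMod 2] (Finset Λ →₀ ZMod 2))
    (e : Finset Λ) (c : Ch (Gr m q)) : th Θ e c = Θ c e := rfl

noncomputable def sg {Λ : Type*} {m q : ℕ} (Θ : Ch (Gr m q) →ₗ[ZMod 2] (Finset Λ →₀ ZMod 2))
    (B : Finset Λ) (k : ℕ) (e : Finset Λ) : ℕ :=
  ∑ e' ∈ B.powerset.filter (fun e' => e ⊆ e' ∧ e'.card ≤ k + 1), sz e'.card (th Θ e')

lemma sz_le_sg {Λ : Type*} {m q : ℕ} (Θ : Ch (Gr m q) →ₗ[ZMod 2] (Finset Λ →₀ ZMod 2))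
    (B : Finset Λ) (k : ℕ) (e : Finset Λ) (he : e ⊆ B) (hc : e.card ≤ k + 1) :
    sz e.card (th Θ e) ≤ sg Θ B k e := by
  unfold sg
  apply Finset.single_le_sum (f := fun e' : Finset Λ => sz e'.card (th Θ e')) (fun _ _ => Nat.zero_le _)
  simp [he, hc]

lemma sum_sg {Λ : Type*} {m q : ℕ} (Θ : Ch (Gr m q) →ₗ[ZMod 2] (Finset Λ →₀ ZMod 2))
    (B : Finset Λ) (k : ℕ) (e : Finset Λ) :
    ∑ b ∈ B \ e, sg Θ B k (insert b e) ≤ (k + 1) * sg Θ B k e := by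
  unfold sg
  simp only [Finset.sum_filter]
  rw [Finset.sum_comm, Finset.mul_sum]
  apply Finset.sum_le_sum
  intro e' _
  rw [← Finset.sum_filter, Finset.sum_const, smul_eq_mul]
  split_ifs with h
  · apply Nat.mul_le_mul_right
    refine le_trans (Finset.card_le_card ?_) h.2
    intro b hb
    simp only [Finset.mem_filter] at hb
    exact hb.2.1 (Finset.mem_insert_self _ _)
  · rw [mul_zero, Nat.le_zero, mul_eq_zero]
    left
    rw [Finset.card_eq_zero, Finset.filter_eq_empty_iff]
    intro b _ h'
    exact h ⟨(Finset.subset_insert _ _).trans h'.1, h'.2⟩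

theorem overlap {Λ : Type*} {m q k : ℕ} (hq : 0 < q)
    (Θ : Ch (Gr m q) →ₗ[ZMod 2] (Finset Λ →₀ ZMod 2)) (B : Finset Λ)
    (h1 : ∀ j ≤ k + 1, ∀ l ∈ G m q j, ∀ e, Θ (Finsupp.single l 1) e ≠ 0 → e ⊆ B ∧ e.card = j)
    (h2 : ∀ j ≤ k + 1, ∀ l ∈ G m q j, fbd (Θ (Finsupp.single l 1)) = Θ (bd (Finsupp.single l 1)))
    (h3 : ∀ l ∈ G m q (k + 2), Θ (bd (Finsupp.single l 1)) = 0)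
    (h0 : Θ (Finsupp.single [] 1) = Finsupp.single ∅ 1)
    (S : ℕ) (hS : ∀ b ∈ B, sg Θ B k {b} ≤ S) :
    q ^ m ≤ ((k + 2) * ((3 * q) * 3 ^ m * (3 ^ m) ^ (k + 1))) ^ k * S := by
  set K := (3 * q) * 3 ^ m * (3 ^ m) ^ (k + 1) with hK
  have hK1 : 1 ≤ K := Nat.one_le_iff_ne_zero.2 (by positivity)
  have main : ∀ r ≤ k, ∃ E : Finset Λ → Dl (Gr m q),
      (∀ e ⊆ B, e.card = k - r + 1 → ∀ l ∈ G m q (k - r + 2),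
        (th Θ e + E e) (bd (Finsupp.single l 1)) = 0) ∧
      (∀ e ⊆ B, e.card = k - r + 1 → sz (k - r + 1) (th Θ e + E e) ≤ ((k + 2) * K) ^ r * sg Θ B k e) ∧
      (∀ e ⊆ B, e.card = k - r → ∀ l ∈ G m q (k - r + 1),
        ∑ b ∈ B \ e, E (insert b e) (Finsupp.single l 1) = 0) := by
    intro r
    induction r with
    | zero =>
      intro _
      refine ⟨fun _ => 0, ?_, ?_, ?_⟩
      · intro e he hc l hl
        rw [add_zero, th_apply, h3 l hl]; rfl
      · intro e he hc
        rw [add_zero, pow_zero, one_mul, ← hc]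
        exact sz_le_sg Θ B k e he (by omega)
      · intro e he hc l hl
        simp
    | succ r ih =>
      intro hr
      obtain ⟨E, hE1, hE2, hE3⟩ := ih (by omega)
      obtain ⟨j, hj⟩ : ∃ j, k - (r + 1) = j := ⟨_, rfl⟩
      have hj' : k - r = j + 1 := by omega
      rw [hj'] at hE1 hE2 hE3
      rw [hj]
      have hH : ∀ e : Finset Λ, ∃ β : Dl (Gr m q), (e ⊆ B → e.card = j + 2 →
          (∀ l ∈ G m q (j+2), β (bd (Finsupp.single l 1)) = (th Θ e + E e) (Finsupp.single l 1)) ∧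
          sz (j+1) β ≤ K * (((k + 2) * K) ^ r * sg Θ B k e)) := by
        intro e
        by_cases he : e ⊆ B ∧ e.card = j + 2
        · obtain ⟨β, hβ, hβ'⟩ := cofill (j := j) hq (th Θ e + E e) (hE1 e he.1 he.2)
          refine ⟨β, fun _ _ => ⟨hβ, hβ'.trans (Nat.mul_le_mul ?_ (hE2 e he.1 he.2))⟩⟩
          rw [hK]
          apply Nat.mul_le_mul_left
          apply Nat.pow_le_pow_right (by positivity)
          omega
        · exact ⟨0, fun a b => absurd ⟨a, b⟩ he⟩
      choose H hH using hH
      have hins : ∀ e ⊆ B, e.card = j + 1 → ∀ b ∈ B \ e, insert b e ⊆ B ∧ (insert b e).card = j + 2 := by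
        intro e he hc b hb
        rw [Finset.mem_sdiff] at hb
        exact ⟨Finset.insert_subset hb.1 he, by rw [Finset.card_insert_of_notMem hb.2, hc]⟩
      refine ⟨fun e => ∑ b ∈ B \ e, H (insert b e), ?_, ?_, ?_⟩
      · intro e he hc l hl
        rw [LinearMap.add_apply, th_apply, ← h2 (j + 2) (by omega) l hl,
          fbd_apply _ e B (fun e' h => (h1 (j+2) (by omega) l hl e' h).1), LinearMap.sum_apply,
          Finset.sum_congr rfl (fun b hb => (hH _ (hins e he hc b hb).1 (hins e he hc b hb).2).1 l hl)]
        simp only [LinearMap.add_apply]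
        rw [Finset.sum_add_distrib, hE3 e he hc l hl, add_zero]
        exact CharTwo.add_self_eq_zero _
      · intro e he hc
        have a1 : sz (j + 1) (th Θ e) ≤ sg Θ B k e := by
          rw [← hc]; exact sz_le_sg Θ B k e he (by omega)
        have a2 : sz (j + 1) (∑ b ∈ B \ e, H (insert b e)) ≤
            K * ((k + 2) * K) ^ r * ((k + 1) * sg Θ B k e) := by
          refine (sz_sum _ _).trans ?_
          refine (Finset.sum_le_sum (fun b hb => (hH _ (hins e he hc b hb).1 (hins e he hc b hb).2).2)).trans ?_
          simp only [← mul_assoc]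
          rw [← Finset.mul_sum]
          rw [mul_assoc (K * ((k + 2) * K) ^ r)]
          exact Nat.mul_le_mul_left _ (sum_sg Θ B k e)
        have a3 : 1 ≤ K * ((k + 2) * K) ^ r := Nat.one_le_iff_ne_zero.2 (by positivity)
        calc _ ≤ _ := sz_add _ _
          _ ≤ 1 * sg Θ B k e + K * ((k + 2) * K) ^ r * ((k + 1) * sg Θ B k e) := by
            rw [one_mul]; exact add_le_add a1 a2
          _ ≤ (K * ((k + 2) * K) ^ r) * sg Θ B k e + K * ((k + 2) * K) ^ r * ((k + 1) * sg Θ B k e) :=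
            Nat.add_le_add_right (Nat.mul_le_mul_right _ a3) _
          _ = _ := by ring
      · intro e he hc l hl
        rw [← LinearMap.sum_apply, double_sum]; rfl
  obtain ⟨E, hE1, hE2, hE3⟩ := main k le_rfl
  rw [Nat.sub_self] at hE1 hE2 hE3
  by_contra! hlt
  have hz : ∀ b ∈ B, ∀ l ∈ G m q 1, (th Θ {b} + E {b}) (Finsupp.single l 1) = 0 := by
    intro b hb l hl
    refine cofill_zero _ (hE1 {b} (by simpa using hb) (by simp)) ?_ l hl
    exact ((hE2 {b} (by simpa using hb) (by simp)).trans (Nat.mul_le_mul_left _ (hS b hb))).trans_lt hlt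
  have hl : [fun _ => ⟨0, hq⟩] ∈ G m q 1 := by
    rw [mem_G]
    refine ⟨rfl, fun a ha b hb => ?_⟩
    simp only [List.mem_singleton] at ha hb
    subst ha; subst hb
    intro i; omega
  have e1 := h2 1 (by omega) _ hl
  have e2 := congrArg (fun c => c ∅) e1
  rw [fbd_apply _ ∅ B (fun e' h => (h1 1 (by omega) _ hl e' h).1)] at e2
  have e3 : ∑ b ∈ B \ ∅, (th Θ (insert b ∅) + E (insert b ∅)) (Finsupp.single [fun _ => ⟨0, hq⟩] 1) = 0 := by
    apply Finset.sum_eq_zero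
    intro b hb
    exact hz b (by simpa using hb) _ hl
  simp only [LinearMap.add_apply] at e3
  rw [Finset.sum_add_distrib, hE3 ∅ (by simp) (by simp) _ hl, add_zero] at e3
  simp only [th_apply] at e3
  rw [e3, single_cons, bd_cone, bd_nil, map_zero, add_zero, h0] at e2
  simp at e2

end GG


namespace GG

def dd (R t : ℤ) : ℤ := min (t % R) (R - t % R)
def uu (S a R t : ℤ) : ℤ := (dd R t + (S - a)) / S
def gg (a R t : ℤ) : ℤ × ℤ :=
  if t % R < a then (0, t / R) else if t % R ≤ R - a then (1, t / R) else (0, t / R + 1)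

lemma em_step (R t : ℤ) (hR : 0 < R) : ((t + 1) % R = t % R + 1 ∧ (t + 1) / R = t / R) ∨
    (t % R = R - 1 ∧ (t + 1) % R = 0 ∧ (t + 1) / R = t / R + 1) := by
  have h1 := Int.emod_nonneg t hR.ne'
  have h2 := Int.emod_lt_of_pos t hR
  have h3 := Int.mul_ediv_add_emod t R
  by_cases h : t % R = R - 1
  · right
    refine ⟨h, ?_, ?_⟩
    · have := (Int.ediv_emod_unique (a := t + 1) (r := 0) (q := t / R + 1) hR).2
        ⟨by rw [mul_add]; linarith, le_rfl, hR⟩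
      exact this.2
    · have := (Int.ediv_emod_unique (a := t + 1) (r := 0) (q := t / R + 1) hR).2
        ⟨by rw [mul_add]; linarith, le_rfl, hR⟩
      exact this.1
  · left
    have := (Int.ediv_emod_unique (a := t + 1) (r := t % R + 1) (q := t / R) hR).2
        ⟨by linarith, by omega, by omega⟩
    exact ⟨this.2, this.1⟩

lemma dd_step (R t : ℤ) (hR : 0 < R) : |dd R (t + 1) - dd R t| ≤ 1 := by
  have h1 := Int.emod_nonneg t hR.ne'
  have h2 := Int.emod_lt_of_pos t hR
  rw [abs_le]
  unfold dd
  rcases em_step R t hR with h | h <;> omega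

lemma dd_lip (R t t' : ℤ) (hR : 0 < R) (h : |t - t'| ≤ 1) : |dd R t - dd R t'| ≤ 1 := by
  rw [abs_le] at h
  obtain h | h | h : t' = t + 1 ∨ t = t' ∨ t = t' + 1 := by omega
  · subst h; rw [abs_sub_comm]; exact dd_step R t hR
  · subst h; simp
  · subst h; exact dd_step R t' hR

lemma gg_step (a R t : ℤ) (ha : 1 ≤ a) (hR : 2 * a ≤ R)
    (h : ¬ (dd R t < a ∧ a ≤ dd R (t + 1))) (h' : ¬ (dd R (t + 1) < a ∧ a ≤ dd R t)) :
    gg a R (t + 1) = gg a R t := by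
  have hR0 : 0 < R := by omega
  have h1 := Int.emod_nonneg t hR0.ne'
  have h2 := Int.emod_lt_of_pos t hR0
  unfold dd at h h'
  unfold gg
  have e := em_step R t hR0
  generalize t % R = r at *
  generalize t / R = p at *
  generalize (t + 1) % R = r' at *
  generalize (t + 1) / R = p' at *
  rcases e with e | e
  · split_ifs <;> first | (exfalso; omega) | (exact Prod.ext rfl (by simp only; omega))
  · split_ifs <;> first | (exfalso; omega) | (exact Prod.ext rfl (by simp only; omega))

lemma gg_lip (a R t t' : ℤ) (ha : 1 ≤ a) (hR : 2 * a ≤ R) (ht : |t - t'| ≤ 1)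
    (h : ¬ (dd R t < a ∧ a ≤ dd R t')) (h' : ¬ (dd R t' < a ∧ a ≤ dd R t)) :
    gg a R t = gg a R t' := by
  rw [abs_le] at ht
  obtain e | e | e : t' = t + 1 ∨ t = t' ∨ t = t' + 1 := by omega
  · subst e; exact (gg_step a R t ha hR h h').symm
  · subst e; rfl
  · subst e; exact gg_step a R t' ha hR h' h

lemma gg_inj (a R t t' : ℤ) (h : gg a R t = gg a R t') (h' : t % R = t' % R) : t = t' := by
  have : t / R = t' / R := by
    unfold gg at h
    rw [h'] at h
    split_ifs at h <;> simp at h <;> exact h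
  rw [← Int.mul_ediv_add_emod t R, ← Int.mul_ediv_add_emod t' R, this, h']

/-- quantised distance is stable off the windows -/
lemma qd_stable (S d d' j : ℤ) (hS : 0 < S) (h2 : 2 ∣ S) (h : |d - d'| ≤ 1) (hj : 0 ≤ j) (hj' : 2 * j + 2 ≤ S)
    (hne : d % S / 2 ≠ j) : (d + (S - (2 * j + 1))) / S = (d' + (S - (2 * j + 1))) / S := by
  have e1 := Int.emod_nonneg d hS.ne'
  have e2 := Int.emod_lt_of_pos d hS
  have e3 := Int.mul_ediv_add_emod d S
  have key : ∀ f : ℤ, |d - f| ≤ 1 → (f + (S - (2 * j + 1))) / S = if d % S < 2 * j then d / S else d / S + 1 := by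
    intro f hf
    rw [abs_le] at hf
    split_ifs with hc
    · refine ((Int.ediv_emod_unique (r := d % S + (f - d) + S - (2 * j + 1)) hS).2 ⟨?_, ?_, ?_⟩).1
      · linarith
      · omega
      · omega
    · refine ((Int.ediv_emod_unique (r := d % S + (f - d) - (2 * j + 1)) hS).2 ⟨?_, ?_, ?_⟩).1
      · rw [mul_add]; linarith
      · omega
      · omega
  rw [key d (by simp), key d' h]

lemma img_sub {ι : Type*} (u : ι → ℤ) (K K' : Finset ι) (hc : K.card = K'.card)
    (h : ∀ i ∈ K, ∀ i' ∉ K, u i ≤ u i') (h' : ∀ i ∈ K', ∀ i' ∉ K', u i ≤ u i') :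
    K.image u ⊆ K'.image u := by
  intro θ hθ
  obtain ⟨i, hi, rfl⟩ := Finset.mem_image.1 hθ
  by_cases hi' : i ∈ K'
  · exact Finset.mem_image_of_mem _ hi'
  · obtain ⟨i', a, b⟩ : ∃ i' ∈ K', i' ∉ K := by
      by_contra! H
      have := Finset.eq_of_subset_of_card_le H hc.le
      subst this
      exact hi' hi
    rw [Finset.mem_image]
    exact ⟨i', a, le_antisymm (h' i' a i hi') (h i hi i' b)⟩

lemma img_eq {ι : Type*} (u : ι → ℤ) (K K' : Finset ι) (hc : K.card = K'.card)
    (h : ∀ i ∈ K, ∀ i' ∉ K, u i ≤ u i') (h' : ∀ i ∈ K', ∀ i' ∉ K', u i ≤ u i') :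
    K.image u = K'.image u :=
  Finset.Subset.antisymm (img_sub u K K' hc h h') (img_sub u K' K hc.symm h' h)

lemma ex_small {ι : Type*} [Fintype ι] (f : ι → ℤ) (k : ℕ) (hk : k ≤ Fintype.card ι) :
    ∃ K : Finset ι, K.card = k ∧ ∀ i ∈ K, ∀ i' ∉ K, f i ≤ f i' := by
  induction k with
  | zero => exact ⟨∅, rfl, by simp⟩
  | succ k ih =>
    obtain ⟨K, hK, h⟩ := ih (by omega)
    have : Kᶜ.Nonempty := by
      rw [← Finset.card_pos, Finset.card_compl]; omega
    obtain ⟨i0, h1, h2⟩ := Finset.exists_min_image Kᶜ f this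
    rw [Finset.mem_compl] at h1
    refine ⟨insert i0 K, by rw [Finset.card_insert_of_notMem h1, hK], ?_⟩
    intro i hi i' hi'
    rw [Finset.mem_insert, not_or] at hi'
    rcases Finset.mem_insert.1 hi with rfl | hi
    · exact h2 i' (by simpa using hi'.2)
    · exact h i hi i' hi'.2

lemma card_win (R lo S : ℤ) :
    ((Finset.Ico (0:ℤ) R).filter (fun r => lo ≤ min r (R - r) ∧ min r (R - r) < lo + S)).card ≤ 2 * S.toNat := by
  calc _ ≤ (Finset.Ico lo (lo + S) ∪ Finset.Ioc (R - lo - S) (R - lo)).card := by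
        apply Finset.card_le_card
        intro r hr
        simp only [Finset.mem_filter, Finset.mem_union, Finset.mem_Ico, Finset.mem_Ioc] at hr ⊢
        omega
    _ ≤ _ := by
        refine (Finset.card_union_le _ _).trans ?_
        simp; omega

lemma card_box {n k : ℕ} (R c : ℕ) (K : Finset (Fin n)) (hK : K.card = k) (P : Fin n → Finset ℤ)
    (hP : ∀ i ∈ K, (P i).card ≤ c) :
    (Fintype.piFinset (fun i => if i ∈ K then P i else Finset.Ico (0:ℤ) R)).card ≤ c ^ k * R ^ (n - k) := by
  rw [Fintype.card_piFinset]
  calc _ ≤ ∏ i : Fin n, (if i ∈ K then c else R) := by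
        apply Finset.prod_le_prod'
        intro i _
        split_ifs with h
        · exact hP i h
        · simp
    _ = _ := by
        rw [Finset.prod_ite]
        simp only [Finset.prod_const]
        congr 2
        · rw [← hK]; congr 1; ext; simp
        · have : Finset.univ.filter (fun i => i ∉ K) = Kᶜ := by ext; simp
          rw [this, Finset.card_compl, hK, Fintype.card_fin]

end GG


namespace GG

abbrev Lab (n : ℕ) := ℕ × Option (Finset ℤ × (Fin n → ℤ × ℤ))

/-- the set of the `k` coordinates closest to the grid -/
noncomputable def KK {n : ℕ} (k : ℕ) (hkn : k ≤ n) (R : ℤ) (x : Fin n → ℤ) : Finset (Fin n) :=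
  (ex_small (fun i => dd R (x i)) k (by simpa using hkn)).choose

lemma KK_card {n : ℕ} (k : ℕ) (hkn : k ≤ n) (R : ℤ) (x : Fin n → ℤ) : (KK k hkn R x).card = k :=
  (ex_small (fun i => dd R (x i)) k (by simpa using hkn)).choose_spec.1

lemma KK_le {n : ℕ} (k : ℕ) (hkn : k ≤ n) (R : ℤ) (x : Fin n → ℤ) :
    ∀ i ∈ KK k hkn R x, ∀ i' ∉ KK k hkn R x, dd R (x i) ≤ dd R (x i') :=
  (ex_small (fun i => dd R (x i)) k (by simpa using hkn)).choose_spec.2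

noncomputable def TT {n : ℕ} (k : ℕ) (hkn : k ≤ n) (R : ℤ) (j : ℕ) (x : Fin n → ℤ) : Finset ℤ :=
  (KK k hkn R x).image (fun i => uu (2 * (k + 1)) (2 * j + 1) R (x i))

noncomputable def lb {n : ℕ} (k : ℕ) (hkn : k ≤ n) (R : ℤ) (j : ℕ) (x : Fin n → ℤ) : Lab n :=
  (j, if TT k hkn R j x ⊆ {0} then none else
    some (TT k hkn R j x, fun i => gg (2 * j + 1) R (x i)))

lemma uu_mono (S a R t t' : ℤ) (hS : 0 < S) (h : dd R t ≤ dd R t') : uu S a R t ≤ uu S a R t' :=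
  Int.ediv_le_ediv hS (by omega)

lemma dd_nonneg (R t : ℤ) (hR : 0 < R) : 0 ≤ dd R t := by
  have h1 := Int.emod_nonneg t hR.ne'
  have h2 := Int.emod_lt_of_pos t hR
  unfold dd; omega

lemma uu_nonneg (S a R t : ℤ) (hS : 0 < S) (ha : a ≤ S) (hR : 0 < R) : 0 ≤ uu S a R t :=
  Int.ediv_nonneg (by have := dd_nonneg R t hR; omega) hS.le

lemma uu_pos (S a R t : ℤ) (hS : 0 < S) : 0 < uu S a R t ↔ a ≤ dd R t := by
  unfold uu
  rw [Int.lt_iff_add_one_le, Int.le_ediv_iff_mul_le hS]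
  omega

lemma lb_const {n : ℕ} (k : ℕ) (hkn : k ≤ n) (R : ℤ) (hR : 4 * (k + 1) ≤ R) (j : ℕ) (hj : j < k + 1)
    (x y : Fin n → ℤ) (hxy : ∀ i, |x i - y i| ≤ 1)
    (hw : ∀ i ∈ KK k hkn R x, dd R (x i) % (2 * (k + 1)) / 2 ≠ j) :
    lb k hkn R j x = lb k hkn R j y := by
  have hR0 : 0 < R := by omega
  have hS : (0 : ℤ) < 2 * (k + 1) := by omega
  have hu : ∀ i ∈ KK k hkn R x, ∀ y' : Fin n → ℤ, |dd R (x i) - dd R (y' i)| ≤ 1 →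
     uu (2 * (k + 1)) (2 * j + 1) R (x i) = uu (2 * (k + 1)) (2 * j + 1) R (y' i) := by
    intro i hi y' h
    exact qd_stable _ _ _ _ hS ⟨_, rfl⟩ h (by omega) (by omega) (hw i hi)
  have hs : ∀ i ∈ KK k hkn R x, ∀ d, |dd R (x i) - d| ≤ 1 → 
     uu (2 * (k + 1)) (2 * j + 1) R (x i) = (d + (2 * (k+1) - (2 * j + 1))) / (2 * (k + 1)) := by
    intro i hi d h
    exact qd_stable _ _ _ _ hS ⟨_, rfl⟩ h (by omega) (by omega) (hw i hi)
  have hd : ∀ i, |dd R (x i) - dd R (y i)| ≤ 1 := fun i => dd_lip R _ _ hR0 (hxy i)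
  -- u at i not in K is large
  have hx2 : ∀ i ∈ KK k hkn R x, ∀ i' ∉ KK k hkn R x,
      uu (2 * (k + 1)) (2 * j + 1) R (x i) ≤ uu (2 * (k + 1)) (2 * j + 1) R (x i') :=
    fun i hi i' hi' => uu_mono _ _ _ _ _ hS (KK_le k hkn R x i hi i' hi')
  have hy2 : ∀ i ∈ KK k hkn R x, ∀ i' ∉ KK k hkn R x,
      uu (2 * (k + 1)) (2 * j + 1) R (x i) ≤ uu (2 * (k + 1)) (2 * j + 1) R (y i') := by
    intro i hi i' hi'
    rw [hs i hi (dd R (x i) - 1) (by simp)]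
    apply Int.ediv_le_ediv hS
    have h1 := KK_le k hkn R x i hi i' hi'
    have h2 := hd i'
    rw [abs_le] at h2
    omega
  have hT : TT k hkn R j x = TT k hkn R j y := by
    have h1 : TT k hkn R j x = (KK k hkn R x).image (fun i => uu (2 * (k + 1)) (2 * j + 1) R (y i)) := by
      unfold TT
      apply Finset.image_congr
      intro i hi
      exact hu i hi y (hd i)
    rw [h1]
    apply img_eq
    · rw [KK_card, KK_card]
    · intro i hi i' hi'
      rw [← hu i hi y (hd i)]
      exact hy2 i hi i' hi'
    · intro i hi i' hi'
      exact uu_mono _ _ _ _ _ hS (KK_le k hkn R y i hi i' hi')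
  unfold lb
  rw [← hT]
  congr 1
  split_ifs with h
  · rfl
  · congr 2
    have hex : ∃ i ∈ KK k hkn R x, 0 < uu (2 * (k + 1)) (2 * j + 1) R (x i) := by
      by_contra! H
      apply h
      intro θ hθ
      obtain ⟨i, hi, rfl⟩ := Finset.mem_image.1 hθ
      rw [Finset.mem_singleton]
      exact le_antisymm (H i hi) (uu_nonneg _ _ _ _ hS (by omega) hR0)
    obtain ⟨i0, hi0, hp⟩ := hex
    ext1 i
    apply gg_lip _ _ _ _ (by omega) (by omega) (hxy i)
    · rintro ⟨a, b⟩
      rw [← uu_pos _ _ _ _ hS] at b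
      have a' : ¬ (0 < uu (2 * (k + 1)) (2 * j + 1) R (x i)) := by
        rw [uu_pos _ _ _ _ hS]; omega
      by_cases hi : i ∈ KK k hkn R x
      · rw [hu i hi y (hd i)] at a'; exact a' b
      · have := hx2 i0 hi0 i hi; omega
    · rintro ⟨a, b⟩
      rw [← uu_pos _ _ _ _ hS] at b
      have a' : ¬ (0 < uu (2 * (k + 1)) (2 * j + 1) R (y i)) := by
        rw [uu_pos _ _ _ _ hS]; omega
      by_cases hi : i ∈ KK k hkn R x
      · rw [hu i hi y (hd i)] at b; exact a' b
      · have := hy2 i0 hi0 i hi; omega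

lemma ex_color {n : ℕ} (k : ℕ) (hkn : k ≤ n) (R : ℤ) (x : Fin n → ℤ) :
    ∃ j < k + 1, ∀ i ∈ KK k hkn R x, dd R (x i) % (2 * (k + 1)) / 2 ≠ (j : ℤ) := by
  have : ((KK k hkn R x).image (fun i => (dd R (x i) % (2 * (k + 1)) / 2).toNat)).card <
      (Finset.range (k + 1)).card := by
    rw [Finset.card_range]
    have := Finset.card_image_le (s := KK k hkn R x) (f := fun i => (dd R (x i) % (2 * (k + 1)) / 2).toNat)
    rw [KK_card] at this
    omega
  obtain ⟨j, h1, h2⟩ := Finset.exists_mem_notMem_of_card_lt_card this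
  refine ⟨j, by simpa using h1, fun i hi h => h2 ?_⟩
  rw [Finset.mem_image]
  exact ⟨i, hi, by rw [h]; simp⟩

noncomputable def col {n : ℕ} (k : ℕ) (hkn : k ≤ n) (R : ℤ) (x : Fin n → ℤ) : ℕ :=
  (ex_color k hkn R x).choose

noncomputable def FF {n : ℕ} (k : ℕ) (hkn : k ≤ n) (R : ℤ) (x : Fin n → ℤ) : Lab n :=
  lb k hkn R (col k hkn R x) x

lemma FF_clique {n : ℕ} (k : ℕ) (hkn : k ≤ n) (R : ℤ) (hR : 4 * (k + 1) ≤ R)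
    (S : Finset (Fin n → ℤ)) (hS : ∀ x ∈ S, ∀ y ∈ S, ∀ i, |x i - y i| ≤ 1) :
    (S.image (FF k hkn R)).card ≤ k + 1 := by
  rcases S.eq_empty_or_nonempty with rfl | ⟨x0, hx0⟩
  · simp
  · calc _ ≤ ((Finset.range (k + 1)).image (fun j => lb k hkn R j x0)).card := by
          apply Finset.card_le_card
          intro b hb
          obtain ⟨x, hx, rfl⟩ := Finset.mem_image.1 hb
          have h := (ex_color k hkn R x).choose_spec
          rw [Finset.mem_image]
          refine ⟨col k hkn R x, Finset.mem_range.2 h.1, ?_⟩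
          exact (lb_const k hkn R hR _ h.1 x x0 (hS x hx x0 hx0) h.2).symm
      _ ≤ k + 1 := Finset.card_image_le.trans (by simp)

end GG


namespace GG

lemma mass_some {n : ℕ} (k : ℕ) (hkn : k ≤ n) (R : ℕ) (hR : 0 < R) (j : ℕ) (v)
    (W : Finset (Fin n → ℤ)) :
    (W.filter (fun x => FF k hkn R x = (j, some v))).card ≤
      2 ^ n * ((k * (2 * (2 * (k + 1)))) ^ k * R ^ (n - k)) := by
  have hR0 : (0 : ℤ) < R := by exact_mod_cast hR
  have hS : (0 : ℤ) < 2 * (k + 1) := by omega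
  obtain ⟨T, g⟩ := v
  rcases (W.filter (fun x => FF k hkn R x = (j, some (T, g)))).eq_empty_or_nonempty with h | ⟨x0, hx0⟩
  · rw [h]; simp
  have hform : ∀ x, FF k hkn R x = (j, some (T, g)) → TT k hkn R j x = T ∧
      (fun i => gg (2 * j + 1) R (x i)) = g := by
    intro x hx
    unfold FF lb at hx
    rw [Prod.mk.injEq] at hx
    obtain ⟨h1, h2⟩ := hx
    rw [h1] at h2
    split_ifs at h2 with h3
    simpa using h2
  have hT : T.card ≤ k := by
    rw [← (hform x0 (Finset.mem_filter.1 hx0).2).1]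
    exact Finset.card_image_le.trans (KK_card _ _ _ _).le
  let P : Finset ℤ := (Finset.Ico (0:ℤ) R).filter
    (fun r : ℤ => (min r (R - r) + (2 * (k + 1) - (2 * j + 1))) / (2 * (k + 1)) ∈ T)
  have hP : P.card ≤ k * (2 * (2 * (k + 1))) := by
    calc P.card ≤ (T.biUnion (fun u => (Finset.Ico (0:ℤ) R).filter (fun r : ℤ =>
          (u * (2 * (k + 1)) - (2 * (k + 1) - (2 * j + 1))) ≤ min r (R - r) ∧
          min r (R - r) < (u * (2 * (k + 1)) - (2 * (k + 1) - (2 * j + 1))) + (2 * (k + 1))))).card := by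
          apply Finset.card_le_card
          intro r hr
          rw [Finset.mem_filter] at hr
          rw [Finset.mem_biUnion]
          refine ⟨_, hr.2, ?_⟩
          rw [Finset.mem_filter]
          refine ⟨hr.1, ?_⟩
          have h1 := Int.ediv_mul_le (min r (R - r) + (2 * (k + 1) - (2 * j + 1) : ℤ)) hS.ne'
          have h2 := Int.lt_ediv_add_one_mul_self (min r (R - r) + (2 * (k + 1) - (2 * j + 1) : ℤ)) hS
          rw [add_mul] at h2
          constructor <;> linarith
      _ ≤ T.card * (2 * (2 * (k + 1))) := by
          apply Finset.card_biUnion_le_card_mul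
          intro u _
          refine (card_win _ _ _).trans ?_
          omega
      _ ≤ _ := Nat.mul_le_mul_right _ hT
  calc _ ≤ ((Finset.univ.filter (fun K : Finset (Fin n) => K.card = k)).biUnion (fun K =>
          Fintype.piFinset (fun i => if i ∈ K then P else Finset.Ico (0:ℤ) R))).card := by
        apply Finset.card_le_card_of_injOn (fun x i => x i % (R:ℤ))
        · intro x hx
          have hx := (Finset.mem_filter.1 (Finset.mem_coe.1 hx)).2
          rw [Finset.mem_coe, Finset.mem_biUnion]
          refine ⟨KK k hkn R x, by simp [KK_card], ?_⟩
          rw [Fintype.mem_piFinset]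
          intro i
          have h1 := Int.emod_nonneg (x i) hR0.ne'
          have h2 := Int.emod_lt_of_pos (x i) hR0
          have h3 : x i % R ∈ Finset.Ico (0:ℤ) R := Finset.mem_Ico.2 ⟨h1, h2⟩
          split_ifs with hi
          · simp only [P, Finset.mem_filter]
            refine ⟨h3, ?_⟩
            rw [← (hform x hx).1]
            exact Finset.mem_image_of_mem _ hi
          · exact h3
        · intro x hx y hy hxy
          have hx := hform x (Finset.mem_filter.1 (Finset.mem_coe.1 hx)).2
          have hy := hform y (Finset.mem_filter.1 (Finset.mem_coe.1 hy)).2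
          ext i
          apply gg_inj (2 * j + 1) R
          · exact congrFun (hx.2.trans hy.2.symm) i
          · exact congrFun hxy i
    _ ≤ (Finset.univ.filter (fun K : Finset (Fin n) => K.card = k)).card * ((k * (2 * (2 * (k + 1)))) ^ k * R ^ (n - k)) := by
        apply Finset.card_biUnion_le_card_mul
        intro K hK
        exact card_box R _ K (by simpa using hK) (fun _ => P) (fun _ _ => hP)
    _ ≤ _ := by
        apply Nat.mul_le_mul_right
        refine (Finset.card_filter_le _ _).trans ?_
        simp

def bad {n : ℕ} (k : ℕ) (R : ℤ) (x : Fin n → ℤ) : Prop :=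
  ∃ K : Finset (Fin n), K.card = k ∧ ∀ i ∈ K, dd R (x i) < 2 * (k + 1)

lemma bad_of_none {n : ℕ} (k : ℕ) (hkn : k ≤ n) (R : ℕ) (j : ℕ) (x : Fin n → ℤ)
    (h : FF k hkn R x = (j, none)) : bad k R x := by
  have hS : (0 : ℤ) < 2 * (k + 1) := by omega
  refine ⟨KK k hkn R x, KK_card _ _ _ _, fun i hi => ?_⟩
  have hc : col k hkn R x < k + 1 := (ex_color k hkn R x).choose_spec.1
  unfold FF lb at h
  rw [Prod.mk.injEq] at h
  have h2 := h.2
  split_ifs at h2 with h3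
  have := h3 (Finset.mem_image_of_mem _ hi)
  rw [Finset.mem_singleton] at this
  have h4 := uu_pos (2 * (k + 1)) (2 * (col k hkn R x : ℤ) + 1) R (x i) hS
  rw [this] at h4
  simp at h4
  omega

lemma ex_shift {n : ℕ} (k : ℕ) (R : ℕ) (hR : 0 < R) (hkn : k ≤ n) (W : Finset (Fin n → ℤ)) (hW : W.card ≤ R ^ n) :
    ∃ a : Fin n → ℤ, (W.filter (fun x => bad k R (x - a))).card ≤
      2 ^ n * ((2 * (2 * (k + 1))) ^ k * R ^ (n - k)) := by
  have hR0 : (0 : ℤ) < R := by exact_mod_cast hR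
  let Bx : Finset (Fin n → ℤ) := Fintype.piFinset (fun _ => Finset.Ico (0:ℤ) R)
  have hBx : Bx.card = R ^ n := by simp [Bx]
  have hone : ∀ x : Fin n → ℤ, (Bx.filter (fun a => bad k R (x - a))).card ≤ 
      2 ^ n * ((2 * (2 * (k + 1))) ^ k * R ^ (n - k)) := by
    intro x
    let P : Fin n → Finset ℤ := fun i => (Finset.Ico (0:ℤ) R).filter (fun s => dd R (x i - s) < 2 * (k + 1))
    have hP : ∀ i, (P i).card ≤ 2 * (2 * (k + 1)) := by
      intro i
      calc (P i).card ≤ ((Finset.Ico (0:ℤ) R).filter (fun r : ℤ => 0 ≤ min r (R - r) ∧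
              min r (R - r) < 0 + (2 * (k + 1) : ℤ))).card := by
            apply Finset.card_le_card_of_injOn (fun s => (x i - s) % (R:ℤ))
            · intro s hs
              have hs := Finset.mem_filter.1 (Finset.mem_coe.1 hs)
              have h1 := Int.emod_nonneg (x i - s) hR0.ne'
              have h2 := Int.emod_lt_of_pos (x i - s) hR0
              have h3 := dd_nonneg R (x i - s) hR0
              rw [Finset.mem_coe, Finset.mem_filter, Finset.mem_Ico]
              refine ⟨⟨h1, h2⟩, h3, ?_⟩
              rw [zero_add]
              exact hs.2
            · intro s hs t ht h
              have hs := Finset.mem_Ico.1 (Finset.mem_filter.1 (Finset.mem_coe.1 hs)).1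
              have ht := Finset.mem_Ico.1 (Finset.mem_filter.1 (Finset.mem_coe.1 ht)).1
              have h' : (x i - s) ≡ (x i - t) [ZMOD R] := h
              have h2 : s ≡ t [ZMOD R] := by
                have := (Int.ModEq.refl (x i)).sub h'
                simpa using this
              have h3 : s % R = t % R := h2
              rwa [Int.emod_eq_of_lt hs.1 hs.2, Int.emod_eq_of_lt ht.1 ht.2] at h3
        _ ≤ _ := (card_win _ _ _).trans (by omega)
    calc _ ≤ ((Finset.univ.filter (fun K : Finset (Fin n) => K.card = k)).biUnion (fun K =>
          Fintype.piFinset (fun i => if i ∈ K then P i else Finset.Ico (0:ℤ) R))).card := by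
          apply Finset.card_le_card
          intro a ha
          rw [Finset.mem_filter] at ha
          obtain ⟨ha, K, hK, h⟩ := ha
          rw [Fintype.mem_piFinset] at ha
          rw [Finset.mem_biUnion]
          refine ⟨K, by simp [hK], ?_⟩
          rw [Fintype.mem_piFinset]
          intro i
          split_ifs with hi
          · exact Finset.mem_filter.2 ⟨ha i, h i hi⟩
          · exact ha i
      _ ≤ (Finset.univ.filter (fun K : Finset (Fin n) => K.card = k)).card * ((2 * (2 * (k + 1))) ^ k * R ^ (n - k)) := by
          apply Finset.card_biUnion_le_card_mul
          intro K hK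
          exact card_box R _ K (by simpa using hK) P (fun i _ => hP i)
      _ ≤ _ := by
          apply Nat.mul_le_mul_right
          refine (Finset.card_filter_le _ _).trans ?_
          simp
  have hsum : ∑ a ∈ Bx, (W.filter (fun x => bad k R (x - a))).card ≤
      ∑ a ∈ Bx, 2 ^ n * ((2 * (2 * (k + 1))) ^ k * R ^ (n - k)) := by
    calc _ = ∑ x ∈ W, (Bx.filter (fun a => bad k R (x - a))).card := by
          simp only [Finset.card_filter]
          exact Finset.sum_comm
      _ ≤ ∑ x ∈ W, 2 ^ n * ((2 * (2 * (k + 1))) ^ k * R ^ (n - k)) := Finset.sum_le_sum (fun x _ => hone x)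
      _ ≤ _ := by
          rw [Finset.sum_const, Finset.sum_const, hBx, smul_eq_mul, smul_eq_mul]
          exact Nat.mul_le_mul_right _ hW
  have hne : Bx.Nonempty := by
    rw [← Finset.card_pos, hBx]; positivity
  obtain ⟨a, _, h⟩ := Finset.exists_le_of_sum_le hne hsum
  exact ⟨a, h⟩

lemma ex_root (n N : ℕ) (hn : 1 ≤ n) (hN : 1 ≤ N) : ∃ t, 1 ≤ t ∧ N ≤ t ^ n ∧ t ^ n ≤ 2 ^ n * N := by
  have hex : ∃ t, N ≤ t ^ n := ⟨N, Nat.le_self_pow (by omega) N⟩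
  have h1 := Nat.find_spec hex
  set t := Nat.find hex with ht
  have ht1 : 1 ≤ t := by
    by_contra! h
    have : t = 0 := by omega
    rw [this, zero_pow (by omega)] at h1
    omega
  refine ⟨t, ht1, h1, ?_⟩
  rcases Nat.eq_or_lt_of_le ht1 with h | h
  · rw [← h, one_pow]
    exact hN.trans (Nat.le_mul_of_pos_left _ (by positivity))
  · have h2 := Nat.find_min hex (m := t - 1) (by omega)
    calc t ^ n ≤ (2 * (t - 1)) ^ n := Nat.pow_le_pow_left (by omega) _
      _ = 2 ^ n * (t - 1) ^ n := mul_pow _ _ _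
      _ ≤ _ := Nat.mul_le_mul_left _ (by omega)

theorem labelling (n k : ℕ) (hk : 1 ≤ k) (hkn : k ≤ n) : ∃ C : ℕ, ∀ W : Finset (Fin n → ℤ), W.Nonempty →
    ∃ (F : (Fin n → ℤ) → Lab n) (R : ℕ), R ^ n ≤ C * W.card ∧
      (∀ S : Finset (Fin n → ℤ), (∀ x ∈ S, ∀ y ∈ S, ∀ i, |x i - y i| ≤ 1) →
        (S.image F).card ≤ k + 1) ∧
      ∀ b, (W.filter (fun x => F x = b)).card ≤ C * R ^ (n - k) := by
  refine ⟨(4 * (k + 1)) ^ n * 2 ^ n + 2 ^ n * (k * (2 * (2 * (k + 1)))) ^ k, fun W hW => ?_⟩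
  obtain ⟨t, ht1, ht2, ht3⟩ := ex_root n W.card (by omega) (Finset.card_pos.2 hW)
  set R := 4 * (k + 1) * t with hR
  have hR0 : 0 < R := by positivity
  have hR1 : 4 * (k + 1) ≤ R := Nat.le_mul_of_pos_right _ ht1
  have hR2 : t ≤ R := Nat.le_mul_of_pos_left _ (by positivity)
  obtain ⟨a, ha⟩ := ex_shift k R hR0 hkn W (ht2.trans (Nat.pow_le_pow_left hR2 _))
  refine ⟨fun x => FF k hkn R (x - a), R, ?_, ?_, ?_⟩
  · rw [add_mul]
    refine le_trans ?_ (Nat.le_add_right _ _)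
    rw [hR, mul_pow, mul_assoc]
    exact Nat.mul_le_mul_left _ ht3
  · intro S hS
    have := FF_clique k hkn R (by exact_mod_cast hR1) (S.image (fun x => x - a)) (by
      intro x hx y hy i
      obtain ⟨x', hx', rfl⟩ := Finset.mem_image.1 hx
      obtain ⟨y', hy', rfl⟩ := Finset.mem_image.1 hy
      simpa using hS x' hx' y' hy' i)
    rwa [Finset.image_image] at this
  · rintro ⟨j, v⟩
    rw [add_mul]
    refine le_trans ?_ (Nat.le_add_left _ _)
    rw [mul_assoc]
    cases v with
    | none =>
      refine le_trans (Finset.card_le_card ?_) (ha.trans ?_)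
      · intro x hx
        rw [Finset.mem_filter] at hx ⊢
        exact ⟨hx.1, bad_of_none k hkn R j _ hx.2⟩
      · apply Nat.mul_le_mul_left
        apply Nat.mul_le_mul_right
        exact Nat.pow_le_pow_left (Nat.le_mul_of_pos_left _ hk) _
    | some v =>
      refine le_trans ?_ (mass_some k hkn R hR0 j v (W.image (fun x => x - a)))
      apply Finset.card_le_card_of_injOn (fun x => x - a)
      · intro x hx
        have hx := Finset.mem_filter.1 (Finset.mem_coe.1 hx)
        exact Finset.mem_coe.2 (Finset.mem_filter.2 ⟨Finset.mem_image_of_mem _ hx.1, hx.2⟩)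
      · intro x _ y _ h
        simpa using h

end GG


namespace GG

def Sm {E : Type*} [NormedAddCommGroup E] (η : ℝ) (K : Set E) (j : ℕ) (l : List E) : Prop :=
  l.length = j ∧ (∀ x ∈ l, x ∈ K) ∧ ∀ x ∈ l, ∀ y ∈ l, dist x y < η

noncomputable def hv {E : Type*} [NormedAddCommGroup E] [NormedSpace ℝ E] (T : ℕ) (z : E) (t : ℕ) (x : E) : E :=
  AffineMap.lineMap x z (((min t T : ℕ) : ℝ) / T)

lemma hv_zero {E : Type*} [NormedAddCommGroup E] [NormedSpace ℝ E] (T : ℕ) (z x : E) : hv T z 0 x = x := by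
  simp [hv]

lemma hv_top {E : Type*} [NormedAddCommGroup E] [NormedSpace ℝ E] (T : ℕ) (hT : 0 < T) (z x : E) (t : ℕ)
    (ht : T ≤ t) : hv T z t x = z := by
  have : (T : ℝ) ≠ 0 := by positivity
  simp [hv, ht, this]

lemma hv_mem {E : Type*} [NormedAddCommGroup E] [NormedSpace ℝ E] {K : Set E} (hK : Convex ℝ K)
    (T : ℕ) (hT : 0 < T) (z x : E) (hz : z ∈ K) (hx : x ∈ K) (t : ℕ) : hv T z t x ∈ K := by
  have hT' : (0 : ℝ) < T := by positivity
  apply hK.lineMap_mem hx hz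
  refine ⟨by positivity, ?_⟩
  rw [div_le_one hT']
  exact_mod_cast min_le_right _ _

lemma hv_dist {E : Type*} [NormedAddCommGroup E] [NormedSpace ℝ E]
    (T : ℕ) (hT : 0 < T) (z x y : E) (t t' : ℕ) (h : t ≤ t' + 1) (h' : t' ≤ t + 1) :
    dist (hv T z t x) (hv T z t' y) ≤ dist x y + dist y z / T := by
  have hT' : (0 : ℝ) < T := by positivity
  refine (dist_triangle _ (hv T z t y) _).trans (add_le_add ?_ ?_)
  · unfold hv
    set s : ℝ := ((min t T : ℕ) : ℝ) / T
    have hs0 : 0 ≤ s := by positivity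
    have hs1 : s ≤ 1 := by
      rw [div_le_one hT']; exact_mod_cast min_le_right _ _
    have : AffineMap.lineMap x z s - AffineMap.lineMap y z s = (1 - s) • (x - y) := by
      simp only [AffineMap.lineMap_apply_module]
      module
    rw [dist_eq_norm, this, norm_smul, Real.norm_of_nonneg (by linarith), dist_eq_norm]
    have := norm_nonneg (x - y)
    nlinarith
  · unfold hv
    rw [dist_lineMap_lineMap, div_eq_inv_mul (dist y z)]
    apply mul_le_mul_of_nonneg_right _ dist_nonneg
    rw [Real.dist_eq, ← sub_div, abs_div, abs_of_pos hT', div_le_iff₀ hT', inv_mul_cancel₀ hT'.ne']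
    have h1 : min t T ≤ min t' T + 1 := by omega
    have h2 : min t' T ≤ min t T + 1 := by omega
    rw [abs_le]
    have h1' : ((min t T : ℕ) : ℝ) ≤ (min t' T : ℕ) + 1 := by exact_mod_cast h1
    have h2' : ((min t' T : ℕ) : ℝ) ≤ (min t T : ℕ) + 1 := by exact_mod_cast h2
    constructor <;> linarith

lemma fill {E : Type*} [NormedAddCommGroup E] [NormedSpace ℝ E] {K : Set E} (hK : Convex ℝ K)
    (η : ℝ) (j : ℕ) (c : Ch E) (hc : c ∈ Sp (Sm η K (j + 1))) (hb : bd c = 0) :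
    ∃ c' : Ch E, c' ∈ Sp (Sm η K (j + 2)) ∧ bd c' = c := by
  by_cases h0 : c = 0
  · exact ⟨0, Submodule.zero_mem _, by rw [h0, map_zero]⟩
  obtain ⟨l0, hl0⟩ : ∃ l, c l ≠ 0 := by
    by_contra! H
    exact h0 (Finsupp.ext H)
  have hs0 := Sp_mem hc hl0
  obtain ⟨z, hz⟩ : ∃ z, z ∈ l0 := List.exists_mem_of_ne_nil l0 (by rintro rfl; simp [Sm] at hs0)
  have hzK := hs0.2.1 z hz
  have hev : ∀ᶠ T : ℕ in atTop, ∀ l ∈ c.support, ∀ x ∈ l.toFinset, ∀ y ∈ l.toFinset,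
      dist x y + dist y z / T < η := by
    rw [Filter.eventually_all_finset]
    intro l hl
    rw [Filter.eventually_all_finset]
    intro x hx
    rw [Filter.eventually_all_finset]
    intro y hy
    have hlt := (Sp_mem hc (Finsupp.mem_support_iff.1 hl)).2.2 x (by simpa using hx) y (by simpa using hy)
    have : Tendsto (fun T : ℕ => dist x y + dist y z / T) atTop (nhds (dist x y + 0)) :=
      tendsto_const_nhds.add (tendsto_const_div_atTop_nhds_zero_nat _)
    rw [add_zero] at this
    exact this.eventually_lt_const hlt
  obtain ⟨T, hT, hT0⟩ := (hev.and (eventually_gt_atTop 0)).exists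
  have hom := contr_homotopy (hv T z) T z (hv_zero T z) c
  rw [hb, map_zero, add_zero] at hom
  refine ⟨contr (hv T z) T z c, ?_, hom⟩
  have hc' : c ∈ Sp (fun l => Sm η K (j+1) l ∧ l ∈ c.support) := by
    rw [Sp, Finsupp.mem_supported]
    intro l hl
    exact ⟨Sp_mem hc (Finsupp.mem_support_iff.1 hl), hl⟩
  refine Sp_map _ _ ?_ hc'
  rintro l ⟨⟨hl1, hl2, hl3⟩, hl⟩
  have hne : l ≠ [] := by rintro rfl; simp at hl1
  refine Sp_mono ?_ (contr_supp (hv T z) T z (fun t ht x => hv_top T hT0 z x t ht) l hne)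
  rintro l' ⟨h1, t, ht, h2⟩
  refine ⟨by omega, ?_, ?_⟩
  · intro y hy
    obtain ⟨x, hx, rfl | rfl⟩ := h2 y hy
    · exact hv_mem hK T hT0 z x hzK (hl2 x hx) t
    · exact hv_mem hK T hT0 z x hzK (hl2 x hx) _
  · intro a ha b hb
    obtain ⟨x, hx, hxa⟩ := h2 a ha
    obtain ⟨y, hy, hyb⟩ := h2 b hb
    have := hT l hl x (by simpa using hx) y (by simpa using hy)
    refine lt_of_le_of_lt ?_ this
    rcases hxa with rfl | rfl <;> rcases hyb with rfl | rfl <;> apply hv_dist T hT0 <;> omega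

lemma exists_Psi {V E : Type*} [NormedAddCommGroup E] [NormedSpace ℝ E] (e : V → E) (η : ℝ) (hη : 0 < η) (j : ℕ) :
    ∃ Ψ : Ch V →ₗ[ZMod 2] Ch E, Ψ (Finsupp.single [] 1) = Finsupp.single [] 1 ∧
      ∀ l : List V, l.length ≤ j + 1 →
        Ψ (Finsupp.single l 1) ∈ Sp (Sm η (convexHull ℝ (e '' {x | x ∈ l})) l.length) ∧
        bd (Ψ (Finsupp.single l 1)) = Ψ (bd (Finsupp.single l 1)) := by
  induction j with
  | zero =>
    refine ⟨mp e, by simp, fun l hl => ⟨?_, (mp_bd e _).symm⟩⟩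
    rw [mp_single]
    apply Sp_single
    refine ⟨by simp, ?_, ?_⟩
    · intro x hx
      obtain ⟨y, hy, rfl⟩ := List.mem_map.1 hx
      exact subset_convexHull ℝ _ ⟨y, hy, rfl⟩
    · match l, hl with
      | [], _ => simp
      | [x], _ => simpa using hη
  | succ j ih =>
    obtain ⟨Ψ, h0, h⟩ := ih
    have hbd : ∀ l : List V, l.length = j + 2 → Ψ (bd (Finsupp.single l 1)) ∈
        Sp (Sm η (convexHull ℝ (e '' {x | x ∈ l})) (j + 1)) := by
      intro l hl
      refine Sp_map Ψ _ ?_ (bd_supp l)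
      rintro l' ⟨a, b⟩
      have h1 := (h l' (by omega)).1
      rw [show l'.length = j + 1 by omega] at h1
      refine Sp_mono ?_ h1
      rintro l'' ⟨c1, c2, c3⟩
      refine ⟨c1, fun x hx => ?_, c3⟩
      exact convexHull_mono (Set.image_mono (fun y hy => a.subset hy)) (c2 x hx)
    have hf : ∀ l : List V, ∃ c : Ch E, l.length = j + 2 → 
        c ∈ Sp (Sm η (convexHull ℝ (e '' {x | x ∈ l})) l.length) ∧ bd c = Ψ (bd (Finsupp.single l 1)) := by
      intro l
      by_cases hl : l.length = j + 2
      · obtain ⟨c', h1, h2⟩ := fill (convex_convexHull ℝ (e '' {x | x ∈ l})) η j (Ψ (bd (Finsupp.single l 1)))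
          (hbd l hl) (by
          have := Sp_eq (bd ∘ₗ Ψ) (Ψ ∘ₗ bd) (fun l' hl' => (h l' (by omega)).2) (bd_supp l)
          simp only [LinearMap.comp_apply] at this
          rw [this, bd_bd, map_zero])
        exact ⟨c', fun _ => ⟨by rw [hl]; exact h1, h2⟩⟩
      · exact ⟨0, fun h => absurd h hl⟩
    choose f hf using hf
    let Ψ' : Ch V →ₗ[ZMod 2] Ch E := Finsupp.linearCombination (ZMod 2)
      (fun l => if l.length = j + 2 then f l else Ψ (Finsupp.single l 1))
    have hs : ∀ l, Ψ' (Finsupp.single l 1) = if l.length = j + 2 then f l else Ψ (Finsupp.single l 1) := by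
      intro l
      simp only [Ψ', Finsupp.linearCombination_single, one_smul]
    have hag : ∀ l : List V, l.length ≤ j + 2 → Ψ' (bd (Finsupp.single l 1)) = Ψ (bd (Finsupp.single l 1)) := by
      intro l hl
      refine Sp_eq Ψ' Ψ (fun l' hl' => ?_) (bd_supp l)
      rw [hs, if_neg (by omega)]
    refine ⟨Ψ', ?_, ?_⟩
    · rw [hs, if_neg (by simp), h0]
    · intro l hl
      rw [hag l hl, hs]
      split_ifs with hl'
      · exact hf l hl'
      · exact h l (by omega)

end GG


namespace GG

noncomputable def cell {n : ℕ} (y : EuclideanSpace ℝ (Fin n)) : Fin n → ℤ := fun i => ⌊y i * (2 * n)⌋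

lemma abs_coord_le {n : ℕ} (y z : EuclideanSpace ℝ (Fin n)) (i : Fin n) : |y i - z i| ≤ dist y z := by
  rw [dist_eq_norm]
  exact PiLp.norm_apply_le (y - z) i

lemma cell_adj {n : ℕ} (y z : EuclideanSpace ℝ (Fin n)) (h : dist y z < 1 / (2 * n)) (i : Fin n) :
    |cell y i - cell z i| ≤ 1 := by
  have hn : (0 : ℝ) < 2 * n := by
    have : 0 < n := i.pos
    positivity
  have h1 := (abs_coord_le y z i).trans_lt h
  rw [lt_div_iff₀ hn, ← abs_of_pos hn, ← abs_mul, sub_mul, abs_lt] at h1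
  simp only [cell]
  have a1 := Int.floor_le (y i * (2 * n))
  have a2 := Int.lt_floor_add_one (y i * (2 * n))
  have b1 := Int.floor_le (z i * (2 * n))
  have b2 := Int.lt_floor_add_one (z i * (2 * n))
  have c1 : (⌊y i * (2 * n)⌋ : ℝ) < ⌊z i * (2 * n)⌋ + 2 := by linarith [h1.1, h1.2]
  have c2 : (⌊z i * (2 * n)⌋ : ℝ) < ⌊y i * (2 * n)⌋ + 2 := by linarith [h1.1, h1.2]
  have d1 : ⌊y i * (2 * n)⌋ < ⌊z i * (2 * n)⌋ + 2 := by exact_mod_cast c1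
  have d2 : ⌊z i * (2 * n)⌋ < ⌊y i * (2 * n)⌋ + 2 := by exact_mod_cast c2
  rw [abs_le]
  constructor <;> linarith

lemma cell_dist {n : ℕ} (y z : EuclideanSpace ℝ (Fin n)) (h : cell y = cell z) : dist y z < 1 := by
  rcases Nat.eq_zero_or_pos n with rfl | hn
  · have : y = z := by ext i; exact i.elim0
    rw [this, dist_self]; exact one_pos
  have hn' : (0 : ℝ) < 2 * n := by positivity
  have hc : ∀ i, |y i - z i| ≤ 1 / (2 * n) := by
    intro i
    have h1 := congrFun h i
    simp only [cell] at h1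
    have h2 := Int.abs_sub_lt_one_of_floor_eq_floor h1
    rw [← sub_mul, abs_mul, abs_of_pos hn'] at h2
    rw [le_div_iff₀ hn']
    exact h2.le
  rw [EuclideanSpace.dist_eq]
  calc √(∑ i, dist (y i) (z i) ^ 2) ≤ √(∑ i : Fin n, (1 / (2 * n)) ^ 2) := by
        apply Real.sqrt_le_sqrt
        apply Finset.sum_le_sum
        intro i _
        rw [Real.dist_eq]
        exact pow_le_pow_left₀ (abs_nonneg _) (hc i) 2
    _ < 1 := by
        rw [Real.sqrt_lt' one_pos]
        rw [Finset.sum_const, Finset.card_univ, Fintype.card_fin, nsmul_eq_mul]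
        have : (1 : ℝ) ≤ n := by exact_mod_cast hn
        rw [div_pow, one_pow, mul_one_div, div_lt_one (by positivity)]
        nlinarith

end GG


namespace GG

noncomputable def cN {n : ℕ} (w : Fin n → ℤ) : Finset (Fin n → ℤ) :=
  Fintype.piFinset (fun i => Finset.Icc (w i - 1) (w i + 1))

lemma card_cN {n : ℕ} (w : Fin n → ℤ) : (cN w).card = 3 ^ n := by
  rw [cN, Fintype.card_piFinset]
  have : ∀ i, (Finset.Icc (w i - 1) (w i + 1)).card = 3 := by
    intro i; simp; omega
  simp [this]

lemma card_fib {m q k : ℕ} (Q : List (Gr m q) → Prop)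
    (hQ : ∀ l l', Q l → Q l' → ∃ x, x ∈ l ∧ x ∈ l') :
    (((Finset.range (k + 2)).biUnion (fun j => G m q j)).filter Q).card ≤
      (k + 2) * ((k + 1) * 3 ^ m) ^ (k + 1) := by
  rcases (((Finset.range (k + 2)).biUnion (fun j => G m q j)).filter Q).eq_empty_or_nonempty with h | ⟨l0, hl0⟩
  · rw [h]; simp
  have hG : ∀ l, l ∈ (((Finset.range (k + 2)).biUnion (fun j => G m q j)).filter Q) →
      l.length < k + 2 ∧ Clq l ∧ Q l := by
    intro l hl
    rw [Finset.mem_filter, Finset.mem_biUnion] at hl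
    obtain ⟨⟨j, hj, h1⟩, h2⟩ := hl
    rw [mem_G] at h1
    rw [Finset.mem_range] at hj
    exact ⟨by omega, h1.2, h2⟩
  let A : Finset (Gr m q) := l0.toFinset.biUnion nb
  have hA : A.card ≤ (k + 1) * 3 ^ m := by
    refine (Finset.card_biUnion_le_card_mul _ _ _ (fun x _ => card_nb x)).trans ?_
    apply Nat.mul_le_mul_right
    have := List.toFinset_card_le l0
    have := (hG l0 hl0).1
    omega
  calc _ ≤ ((Finset.range (k + 2)).biUnion (fun j => lst A j)).card := by
        apply Finset.card_le_card
        intro l hl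
        obtain ⟨h1, h2, h3⟩ := hG l hl
        rw [Finset.mem_biUnion]
        refine ⟨l.length, Finset.mem_range.2 h1, ?_⟩
        rw [mem_lst]
        refine ⟨rfl, fun y hy => ?_⟩
        obtain ⟨x, hx, hx'⟩ := hQ l l0 h3 (hG l0 hl0).2.2
        simp only [A, Finset.mem_biUnion, List.mem_toFinset]
        exact ⟨x, hx', by simpa [nb] using h2 x hx y hy⟩
    _ ≤ (Finset.range (k + 2)).card * ((k + 1) * 3 ^ m) ^ (k + 1) := by
        apply Finset.card_biUnion_le_card_mul
        intro j hj
        rw [Finset.mem_range] at hj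
        refine (card_lst A j).trans ((Nat.pow_le_pow_left hA j).trans ?_)
        exact Nat.pow_le_pow_right (by positivity) (by omega)
    _ = _ := by rw [Finset.card_range]

theorem core {m q k n C : ℕ} (hq : 0 < q) (hn : 0 < n)
    {E : Type*} [NormedAddCommGroup E] [NormedSpace ℝ E] (e : Gr m q → E)
    (J : E → EuclideanSpace ℝ (Fin n)) (hJ : Continuous J)
    (hthick : ∀ l l' : List (Gr m q), l ≠ [] → l' ≠ [] → Clq l → Clq l' → l.length ≤ k + 1 →
      l'.length ≤ k + 1 → (∀ x ∈ l, x ∉ l') → ∀ p ∈ convexHull ℝ (e '' {x | x ∈ l}),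
      ∀ p' ∈ convexHull ℝ (e '' {x | x ∈ l'}), 1 ≤ dist (J p) (J p'))
    (W : Finset (Fin n → ℤ))
    (hW : ∀ l : List (Gr m q), Clq l → l.length ≤ k + 1 → ∀ p ∈ convexHull ℝ (e '' {x | x ∈ l}), cell (J p) ∈ W)
    (F : (Fin n → ℤ) → Lab n) (R : ℕ)
    (hF : ∀ S : Finset (Fin n → ℤ), (∀ x ∈ S, ∀ y ∈ S, ∀ i, |x i - y i| ≤ 1) →
        (S.image F).card ≤ k + 1)
    (hF' : ∀ b, (W.filter (fun x => F x = b)).card ≤ C * R ^ (n - k)) :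
    q ^ m ≤ ((k + 2) * ((3 * q) * 3 ^ m * (3 ^ m) ^ (k + 1))) ^ k *
      ((C * R ^ (n - k)) * (2 ^ (3 ^ n) * ((k + 2) * ((k + 1) * 3 ^ m) ^ (k + 1)))) := by
  have hh : (0 : ℝ) < 1 / (2 * n) := by positivity
  have hcomp : IsCompact (convexHull ℝ (Set.range e)) := (Set.finite_range e).isCompact_convexHull ℝ
  have huc := hcomp.uniformContinuousOn_of_continuous hJ.continuousOn
  rw [Metric.uniformContinuousOn_iff] at huc
  obtain ⟨η, hη, huc⟩ := huc _ hh
  obtain ⟨Ψ, hΨ0, hΨ⟩ := exists_Psi e η hη (k + 1)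
  let f : E → Lab n := fun p => F (cell (J p))
  let Θ : Ch (Gr m q) →ₗ[ZMod 2] (Finset (Lab n) →₀ ZMod 2) := pj ∘ₗ mp f ∘ₗ Ψ
  have hsupp : ∀ l : List (Gr m q), l.length ≤ k + 2 → ∀ s, Θ (Finsupp.single l 1) s ≠ 0 →
      ∃ l', Sm η (convexHull ℝ (e '' {x | x ∈ l})) l.length l' ∧ s = (l'.map f).toFinset ∧
        s.card = l.length := by
    intro l hl s hs
    obtain ⟨l', h1, h2⟩ := exists_ne (Finsupp.lapply s ∘ₗ pj ∘ₗ mp f) (hΨ l hl).1 hs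
    simp only [LinearMap.comp_apply, mp_single, Finsupp.lapply_apply] at h2
    obtain ⟨h3, h4⟩ := pj_supp _ _ h2
    exact ⟨l', h1, by rw [h3]; congr!, by rw [h4, List.length_map, h1.1]⟩
  have hclq : ∀ l : List (Gr m q), ∀ l', Sm η (convexHull ℝ (e '' {x | x ∈ l})) l.length l' →
      ∀ x ∈ l', ∀ y ∈ l', ∀ i, |cell (J x) i - cell (J y) i| ≤ 1 := by
    intro l l' h x hx y hy i
    apply cell_adj
    apply huc
    · exact convexHull_mono (Set.image_subset_range _ _) (h.2.1 x hx)
    · exact convexHull_mono (Set.image_subset_range _ _) (h.2.1 y hy)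
    · exact h.2.2 x hx y hy
  have h2 : ∀ l : List (Gr m q), l.length ≤ k + 2 →
      fbd (Θ (Finsupp.single l 1)) = Θ (bd (Finsupp.single l 1)) := by
    intro l hl
    simp only [Θ, LinearMap.comp_apply]
    rw [← pj_bd, ← mp_bd, (hΨ l hl).2]
  refine overlap hq Θ (W.image F) ?_ ?_ ?_ ?_ _ ?_
  · intro j hj l hl s hs
    rw [mem_G] at hl
    obtain ⟨l', h3, h4, h5⟩ := hsupp l (by omega) s hs
    refine ⟨?_, by rw [h5, hl.1]⟩
    intro b hb
    rw [h4, List.mem_toFinset, List.mem_map] at hb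
    obtain ⟨p, hp, rfl⟩ := hb
    exact Finset.mem_image_of_mem _ (hW l hl.2 (by omega) p (h3.2.1 p hp))
  · intro j hj l hl
    rw [mem_G] at hl
    exact h2 l (by omega)
  · intro l hl
    rw [mem_G] at hl
    rw [← h2 l (by omega)]
    have : Θ (Finsupp.single l 1) = 0 := by
      ext s
      by_contra hs
      obtain ⟨l', h3, h4, h5⟩ := hsupp l (by omega) s hs
      have := hF (l'.map (fun p => cell (J p))).toFinset (by
        intro x hx y hy
        rw [List.mem_toFinset, List.mem_map] at hx hy
        obtain ⟨x', hx', rfl⟩ := hx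
        obtain ⟨y', hy', rfl⟩ := hy
        exact hclq l l' h3 x' hx' y' hy')
      have h6 : s = ((l'.map (fun p => cell (J p))).toFinset).image F := by
        rw [h4]; ext b; simp [f]
      rw [← h6] at this
      omega
    rw [this, map_zero]
  · simp only [Θ, LinearMap.comp_apply]
    rw [hΨ0, mp_single]
    simp [pj, pjL]
  · intro b hb
    unfold sg sz
    rw [← Finset.card_sigma]
    let Q : (Fin n → ℤ) → List (Gr m q) → Prop := fun w l =>
      (l ≠ [] ∧ Clq l ∧ l.length ≤ k + 1) ∧ ∃ p ∈ convexHull ℝ (e '' {x | x ∈ l}), cell (J p) = w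
    have hQ : ∀ w l l', Q w l → Q w l' → ∃ x, x ∈ l ∧ x ∈ l' := by
      rintro w l l' ⟨⟨a1, a2, a3⟩, p, hp, hpw⟩ ⟨⟨b1, b2, b3⟩, p', hp', hpw'⟩
      by_contra! H
      have h3 := hthick l l' a1 b1 a2 b2 a3 b3 H p hp p' hp'
      have h4 := cell_dist (J p) (J p') (hpw.trans hpw'.symm)
      linarith
    calc _ ≤ ((W.filter (fun x => F x = b)).biUnion (fun w =>
          ((cN w).image F).powerset ×ˢ (((Finset.range (k + 2)).biUnion (fun j => G m q j)).filter (Q w)))).card := by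
          apply Finset.card_le_card_of_injOn (fun p => (p.1, p.2))
          · rintro ⟨s, l⟩ hp
            rw [Finset.mem_coe, Finset.mem_sigma] at hp
            obtain ⟨hs, hl⟩ := hp
            simp only [Finset.mem_filter, Finset.mem_powerset, Finset.singleton_subset_iff] at hs hl
            obtain ⟨hs1, hs2, hs3⟩ := hs
            obtain ⟨hl1, hl2⟩ := hl
            have hl1' := hl1
            rw [mem_G] at hl1
            obtain ⟨l', h3, h4, h5⟩ := hsupp l (by omega) s hl2
            have hb' : b ∈ (l'.map f).toFinset := by rw [← h4]; exact hs2
            rw [List.mem_toFinset, List.mem_map] at hb'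
            obtain ⟨p, hp, hpb⟩ := hb'
            have hpl := h3.2.1 p hp
            rw [Finset.mem_coe, Finset.mem_biUnion]
            refine ⟨cell (J p), Finset.mem_filter.2 ⟨hW l hl1.2 (by omega) p hpl, hpb⟩, ?_⟩
            rw [Finset.mem_product, Finset.mem_powerset, Finset.mem_filter, Finset.mem_biUnion]
            refine ⟨?_, ⟨s.card, Finset.mem_range.2 (by omega), hl1'⟩, ⟨?_, hl1.2, by simp only; omega⟩, p, hpl, rfl⟩
            · intro b' hb'
              simp only [h4] at hb'
              rw [List.mem_toFinset, List.mem_map] at hb'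
              obtain ⟨p', hp', rfl⟩ := hb'
              apply Finset.mem_image_of_mem
              rw [cN, Fintype.mem_piFinset]
              intro i
              have := hclq l l' h3 p' hp' p hp i
              rw [abs_le] at this
              rw [Finset.mem_Icc]
              omega
            · rintro rfl
              simp at hpl
          · rintro ⟨z, l⟩ _ ⟨z', l'⟩ _ h
            simp only [Prod.mk.injEq] at h
            rw [h.1, h.2]
      _ ≤ (W.filter (fun x => F x = b)).card * (2 ^ (3 ^ n) * ((k + 2) * ((k + 1) * 3 ^ m) ^ (k + 1))) := by
          apply Finset.card_biUnion_le_card_mul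
          intro w _
          rw [Finset.card_product, Finset.card_powerset]
          apply Nat.mul_le_mul
          · apply Nat.pow_le_pow_right (by norm_num)
            rw [← card_cN w]
            exact Finset.card_image_le
          · convert card_fib (k := k) (Q w) (hQ w)
      _ ≤ _ := Nat.mul_le_mul_right _ (hF' b)

end GG


namespace GG

noncomputable def ev (m q : ℕ) (x : Gr m q) : EuclideanSpace ℝ (Fin (Fintype.card (Gr m q))) :=
  EuclideanSpace.single (Fintype.equivFin _ x) 1

lemma ev_indep (m q : ℕ) : AffineIndependent ℝ (ev m q) := by
  have h := (EuclideanSpace.basisFun (Fin (Fintype.card (Gr m q))) ℝ).toBasis.linearIndependent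
  have h2 : LinearIndependent ℝ (ev m q) := by
    have := h.comp (Fintype.equivFin (Gr m q)) (Equiv.injective _)
    have e : ev m q = (EuclideanSpace.basisFun (Fin (Fintype.card (Gr m q))) ℝ).toBasis ∘ (Fintype.equivFin (Gr m q)) := by
      funext x
      simp [ev]
    rw [e]
    exact this
  exact h2.affineIndependent

lemma ev_inj (m q : ℕ) : Function.Injective (ev m q) := (ev_indep m q).injective

noncomputable def fc (k m q : ℕ) : Finset (Finset (Gr m q)) :=
  Finset.univ.filter (fun t => t.Nonempty ∧ t.card ≤ k + 1 ∧ ∀ x ∈ t, ∀ y ∈ t, adj x y)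

noncomputable def im (m q : ℕ) (t : Finset (Gr m q)) :
    Finset (EuclideanSpace ℝ (Fin (Fintype.card (Gr m q)))) := t.map ⟨ev m q, ev_inj m q⟩

lemma im_inj (m q : ℕ) : Function.Injective (im m q) := Finset.map_injective _

noncomputable def cx (k m q : ℕ) :
    Geometry.SimplicialComplex ℝ (EuclideanSpace ℝ (Fin (Fintype.card (Gr m q)))) where
  faces := im m q '' (fc k m q : Set _)
  isRelLowerSet_faces := by
    rintro _ ⟨t, ht, rfl⟩
    simp only [fc, Finset.coe_filter, Finset.mem_univ, true_and, Set.mem_ofPred_eq] at ht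
    refine ⟨by simpa [im] using ht.1, ?_⟩
    intro u hu hne
    have hu' : u ⊆ t.map ⟨ev m q, ev_inj m q⟩ := hu
    obtain ⟨v, hv, rfl⟩ := Finset.subset_map_iff.1 hu'
    refine ⟨v, ?_, rfl⟩
    simp only [fc, Finset.coe_filter, Finset.mem_univ, true_and, Set.mem_ofPred_eq]
    exact ⟨by simpa using hne, (Finset.card_le_card hv).trans ht.2.1,
      fun x hx y hy => ht.2.2 x (hv hx) y (hv hy)⟩
  indep := by
    rintro _ ⟨t, ht, rfl⟩
    refine (ev_indep m q).range.mono ?_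
    intro x hx
    simp only [im, Finset.coe_map] at hx
    exact Set.image_subset_range _ _ hx
  inter_subset_convexHull := by
    rintro _ _ ⟨t, ht, rfl⟩ ⟨u, hu, rfl⟩
    have key : AffineIndependent ℝ ((↑) : (im m q Finset.univ) → EuclideanSpace ℝ (Fin (Fintype.card (Gr m q)))) := by
      refine (ev_indep m q).range.mono ?_
      intro x hx
      simp only [im, Finset.coe_map] at hx
      exact Set.image_subset_range _ _ hx
    have := key.convexHull_inter (t₁ := im m q t) (t₂ := im m q u)
      (Finset.map_subset_map.2 (Finset.subset_univ _)) (Finset.map_subset_map.2 (Finset.subset_univ _))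
    rw [← this]

lemma cx_faces (k m q : ℕ) : (cx k m q).faces = im m q '' (fc k m q : Set _) := rfl

lemma cx_fin (k m q : ℕ) : (cx k m q).faces.Finite := (Finset.finite_toSet _).image _

lemma cx_ncard (k m q : ℕ) : (cx k m q).faces.ncard = (fc k m q).card := by
  rw [cx_faces, Set.ncard_image_of_injective _ (im_inj m q), Set.ncard_coe_finset]

lemma cx_dim (k m q : ℕ) : ∀ s ∈ (cx k m q).faces, s.card ≤ k + 1 := by
  rintro _ ⟨t, ht, rfl⟩
  simp only [fc, Finset.coe_filter, Finset.mem_univ, true_and, Set.mem_ofPred_eq] at ht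
  simpa [im] using ht.2.1

lemma fc_deg (k m q : ℕ) (x : Gr m q) : ((fc k m q).filter (fun t => x ∈ t)).card ≤ 2 ^ (3 ^ m) := by
  calc _ ≤ (nb x).powerset.card := by
        apply Finset.card_le_card
        intro t ht
        simp only [fc, Finset.mem_filter, Finset.mem_univ, true_and] at ht
        rw [Finset.mem_powerset]
        intro y hy
        simpa [nb] using ht.1.2.2 x ht.2 y hy
    _ ≤ _ := by
        rw [Finset.card_powerset]
        exact Nat.pow_le_pow_right (by norm_num) (card_nb x)

lemma cx_deg (k m q : ℕ) : ∀ v ∈ (cx k m q).vertices,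
    {s | s ∈ (cx k m q).faces ∧ v ∈ s}.ncard ≤ 2 ^ (3 ^ m) := by
  intro v hv
  have hv' : {v} ∈ (cx k m q).faces := hv
  obtain ⟨t, ht, htv⟩ := hv'
  have : v ∈ im m q t := by rw [htv]; simp
  simp only [im, Finset.mem_map, Function.Embedding.coeFn_mk] at this
  obtain ⟨x, hx, rfl⟩ := this
  have hs : {s | s ∈ (cx k m q).faces ∧ ev m q x ∈ s} ⊆
      im m q '' (((fc k m q).filter (fun t => x ∈ t) : Finset _) : Set _) := by
    rintro _ ⟨⟨u, hu, rfl⟩, h⟩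
    refine ⟨u, ?_, rfl⟩
    simp only [im, Finset.mem_map, Function.Embedding.coeFn_mk] at h
    obtain ⟨y, hy, hxy⟩ := h
    rw [ev_inj m q hxy] at hy
    rw [Finset.coe_filter]
    exact ⟨hu, hy⟩
  refine (Set.ncard_le_ncard hs ((Finset.finite_toSet _).image _)).trans ?_
  rw [Set.ncard_image_of_injective _ (im_inj m q), Set.ncard_coe_finset]
  exact fc_deg k m q x

lemma card_Gr (m q : ℕ) : Fintype.card (Gr m q) = q ^ m := by simp [Gr]

lemma fc_ge (k m q : ℕ) : q ^ m ≤ (fc k m q).card := by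
  rw [← card_Gr, ← Finset.card_univ]
  apply Finset.card_le_card_of_injOn (fun x => {x})
  · intro x _
    simp only [fc, Finset.coe_filter, Finset.mem_univ, true_and, Set.mem_ofPred_eq]
    refine ⟨by simp, by simp, ?_⟩
    simp [adj]
  · intro x _ y _ h
    simpa using h

lemma fc_le (k m q : ℕ) : (fc k m q).card ≤ q ^ m * 2 ^ (3 ^ m) := by
  have : fc k m q ⊆ Finset.univ.biUnion (fun x => (fc k m q).filter (fun t => x ∈ t)) := by
    intro t ht
    have h := ht
    simp only [fc, Finset.mem_filter, Finset.mem_univ, true_and] at h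
    obtain ⟨x, hx⟩ := h.1
    simp only [Finset.mem_biUnion, Finset.mem_univ, true_and, Finset.mem_filter]
    exact ⟨x, ht, hx⟩
  refine (Finset.card_le_card this).trans ?_
  refine (Finset.card_biUnion_le_card_mul _ _ _ (fun x _ => fc_deg k m q x)).trans ?_
  rw [Finset.card_univ, card_Gr]

lemma cl_face {k m q : ℕ} {l : List (Gr m q)} (h : Clq l) (hl : l ≠ []) (hk : l.length ≤ k + 1) :
    im m q l.toFinset ∈ (cx k m q).faces := by
  refine ⟨_, ?_, rfl⟩
  simp only [fc, Finset.coe_filter, Finset.mem_univ, true_and, Set.mem_ofPred_eq]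
  refine ⟨by simpa using hl, (List.toFinset_card_le l).trans hk, ?_⟩
  intro x hx y hy
  exact h x (by simpa using hx) y (by simpa using hy)

lemma coe_im {m q : ℕ} (l : List (Gr m q)) :
    (im m q l.toFinset : Set _) = ev m q '' {x | x ∈ l} := by
  ext x
  simp [im]

lemma cx_compact (k m q : ℕ) : IsCompact (cx k m q).space := by
  rw [Geometry.SimplicialComplex.space]
  exact (cx_fin k m q).isCompact_biUnion (fun s _ => s.finite_toSet.isCompact_convexHull ℝ)

end GG


namespace GG

lemma vol_cell {n : ℕ} (hn : 0 < n) (w : Fin n → ℤ) :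
    volume {y : EuclideanSpace ℝ (Fin n) | cell y = w} = ENNReal.ofReal ((1 / (2 * n)) ^ n) ∧
    MeasurableSet {y : EuclideanSpace ℝ (Fin n) | cell y = w} := by
  have h2 : (0 : ℝ) < 2 * n := by positivity
  have he : {y : EuclideanSpace ℝ (Fin n) | cell y = w} =
      (@WithLp.ofLp 2 (Fin n → ℝ)) ⁻¹' (Set.univ.pi (fun i => Set.Ico ((w i : ℝ) / (2 * n)) (((w i : ℝ) + 1) / (2 * n)))) := by
    ext y
    simp only [Set.mem_ofPred_eq, Set.mem_preimage, Set.mem_pi, Set.mem_univ, true_imp_iff, Set.mem_Ico,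
      funext_iff, cell]
    refine forall_congr' fun i => ?_
    rw [Int.floor_eq_iff, div_le_iff₀ h2, lt_div_iff₀ h2]
  have hm : MeasurableSet (Set.univ.pi (fun i => Set.Ico ((w i : ℝ) / (2 * n)) (((w i : ℝ) + 1) / (2 * n)))) :=
    MeasurableSet.univ_pi (fun i => measurableSet_Ico)
  have hp := PiLp.volume_preserving_ofLp (Fin n)
  rw [he]
  refine ⟨?_, hp.measurable hm⟩
  rw [hp.measure_preimage hm.nullMeasurableSet, Real.volume_pi_Ico]
  have : ∀ i, ((w i : ℝ) + 1) / (2 * n) - (w i : ℝ) / (2 * n) = 1 / (2 * n) := by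
    intro i; ring
  simp only [this]
  rw [Finset.prod_const, Finset.card_univ, Fintype.card_fin, ENNReal.ofReal_pow (by positivity)]

lemma vol_ge {n : ℕ} (hn : 0 < n) (S : Set (EuclideanSpace ℝ (Fin n))) (W : Finset (Fin n → ℤ))
    (hW : ∀ w ∈ W, ∃ y ∈ S, cell y = w) :
    ENNReal.ofReal (W.card * (1 / (2 * n)) ^ n) ≤ volume (Metric.thickening 1 S) := by
  have h1 : (⋃ w ∈ W, {y : EuclideanSpace ℝ (Fin n) | cell y = w}) ⊆ Metric.thickening 1 S := by
    intro z hz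
    simp only [Set.mem_iUnion, Set.mem_ofPred_eq] at hz
    obtain ⟨w, hw, hz⟩ := hz
    obtain ⟨y, hy, hyw⟩ := hW w hw
    rw [Metric.mem_thickening_iff]
    exact ⟨y, hy, cell_dist _ _ (hz.trans hyw.symm)⟩
  refine le_trans ?_ (measure_mono h1)
  rw [measure_biUnion_finset]
  · rw [Finset.sum_congr rfl (fun w _ => (vol_cell hn w).1), Finset.sum_const, nsmul_eq_mul,
      ENNReal.ofReal_mul (by positivity), ENNReal.ofReal_natCast]
  · intro a _ b _ hab
    simp only [Function.onFun, Set.disjoint_left, Set.mem_ofPred_eq]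
    intro y h1 h2
    exact hab (h1.symm.trans h2)
  · intro w _
    exact (vol_cell hn w).2

lemma cells_finite {n : ℕ} (S : Set (EuclideanSpace ℝ (Fin n))) (hS : IsCompact S) :
    (cell '' S).Finite := by
  obtain ⟨r, hr⟩ := hS.isBounded.subset_closedBall 0
  apply (Set.Finite.pi' (fun i : Fin n => Set.finite_Icc (⌊-r * (2 * n)⌋) (⌊r * (2 * n)⌋))).subset
  rintro _ ⟨y, hy, rfl⟩ i
  have h := (abs_coord_le y 0 i).trans (hr hy)
  simp only [PiLp.zero_apply, sub_zero, abs_le] at h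
  have h2 : (0 : ℝ) ≤ 2 * n := by positivity
  exact ⟨Int.floor_mono (mul_le_mul_of_nonneg_right h.1 h2), Int.floor_mono (mul_le_mul_of_nonneg_right h.2 h2)⟩

end GG

namespace GG

lemma numer {n k m q N w R A C L : ℕ} (hkn : k < n) (ε : ℝ) (hε : 0 < ε)
    (hm : (k : ℝ) * ((n : ℝ) / ((n : ℝ) - k)) ≤ m * ε) (hq : 0 < q)
    (h1 : q ^ m ≤ A * q ^ k * R ^ (n - k)) (h2 : R ^ n ≤ C * w)
    (hN1 : q ^ m ≤ N) (hN2 : N ≤ q ^ m * L) :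
    (N : ℝ) ^ ((n : ℝ) / ((n : ℝ) - (k : ℝ)) - ε) ≤
      max 1 ((L : ℝ) ^ ((n : ℝ) / ((n : ℝ) - (k : ℝ)) - ε)) *
        (((A : ℝ) + 1) ^ ((n : ℝ) / ((n : ℝ) - (k : ℝ))) * (((C : ℝ) + 1) * w)) := by
  have hnk : (0 : ℝ) < (n : ℝ) - k := by
    have : (k : ℝ) < n := by exact_mod_cast hkn
    linarith
  set p : ℝ := (n : ℝ) / ((n : ℝ) - k) with hp
  have hp0 : 0 ≤ p := by positivity
  have hq1 : (1 : ℝ) ≤ q := by exact_mod_cast hq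
  have hq0 : (0 : ℝ) < q := by linarith
  have h1' : (q : ℝ) ^ ((m : ℝ) - k) ≤ ((A : ℝ) + 1) * (R : ℝ) ^ ((n : ℝ) - k) := by
    have e : (R : ℝ) ^ ((n : ℝ) - k) = (R : ℝ) ^ (n - k) := by
      rw [← Nat.cast_sub hkn.le, Real.rpow_natCast]
    rw [Real.rpow_sub hq0, Real.rpow_natCast, Real.rpow_natCast, div_le_iff₀ (by positivity), e]
    have : ((q ^ m : ℕ) : ℝ) ≤ ((A * q ^ k * R ^ (n - k) : ℕ) : ℝ) := by exact_mod_cast h1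
    push_cast at this
    have h3 : (0 : ℝ) ≤ q ^ k * R ^ (n - k) := by positivity
    nlinarith
  have h3 : (q : ℝ) ^ (((m : ℝ) - k) * p) ≤ ((A : ℝ) + 1) ^ p * (((C : ℝ) + 1) * w) := by
    rw [Real.rpow_mul hq0.le]
    refine (Real.rpow_le_rpow (by positivity) h1' hp0).trans ?_
    rw [Real.mul_rpow (by positivity) (by positivity), ← Real.rpow_mul (by positivity),
      show ((n : ℝ) - k) * p = n by rw [hp]; field_simp, Real.rpow_natCast]
    gcongr
    have : ((R ^ n : ℕ) : ℝ) ≤ ((C * w : ℕ) : ℝ) := by exact_mod_cast h2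
    push_cast at this
    have h4 : (0 : ℝ) ≤ w := by positivity
    nlinarith
  have h4 : ((q : ℝ) ^ m) ^ (p - ε) ≤ (q : ℝ) ^ (((m : ℝ) - k) * p) := by
    rw [← Real.rpow_natCast, ← Real.rpow_mul hq0.le]
    apply Real.rpow_le_rpow_of_exponent_le hq1
    nlinarith
  have hN1' : (q : ℝ) ^ m ≤ N := by exact_mod_cast hN1
  have hN2' : (N : ℝ) ≤ (q : ℝ) ^ m * L := by exact_mod_cast hN2
  have hqm : (0 : ℝ) < (q : ℝ) ^ m := by positivity
  have h5 : (N : ℝ) ^ (p - ε) ≤ max 1 ((L : ℝ) ^ (p - ε)) * ((q : ℝ) ^ m) ^ (p - ε) := by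
    have h0 : 0 ≤ ((q : ℝ) ^ m) ^ (p - ε) := by positivity
    rcases le_total 0 (p - ε) with h | h
    · calc (N : ℝ) ^ (p - ε) ≤ ((q : ℝ) ^ m * L) ^ (p - ε) := Real.rpow_le_rpow (by positivity) hN2' h
        _ = (L : ℝ) ^ (p - ε) * ((q : ℝ) ^ m) ^ (p - ε) := by
          rw [Real.mul_rpow (by positivity) (by positivity), mul_comm]
        _ ≤ _ := mul_le_mul_of_nonneg_right (le_max_right _ _) h0
    · calc (N : ℝ) ^ (p - ε) ≤ ((q : ℝ) ^ m) ^ (p - ε) := Real.rpow_le_rpow_of_nonpos hqm hN1' h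
        _ = 1 * ((q : ℝ) ^ m) ^ (p - ε) := (one_mul _).symm
        _ ≤ _ := mul_le_mul_of_nonneg_right (le_max_left _ _) h0
  refine h5.trans (mul_le_mul_of_nonneg_left (h4.trans h3) (by positivity))

lemma geom {n k m q C : ℕ} (hn : 0 < n) (hq : 0 < q)
    (hC : ∀ W : Finset (Fin n → ℤ), W.Nonempty → ∃ (F : (Fin n → ℤ) → Lab n) (R : ℕ),
      R ^ n ≤ C * W.card ∧
      (∀ S : Finset (Fin n → ℤ), (∀ x ∈ S, ∀ y ∈ S, ∀ i, |x i - y i| ≤ 1) →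
        (S.image F).card ≤ k + 1) ∧
      ∀ b, (W.filter (fun x => F x = b)).card ≤ C * R ^ (n - k))
    (I : (cx k m q).space → EuclideanSpace ℝ (Fin n)) (hI : Continuous I)
    (hT : HasCombThickness (cx k m q) I 1) :
    ∃ w R : ℕ, R ^ n ≤ C * w ∧
      q ^ m ≤ ((k + 2) * ((3 * q) * 3 ^ m * (3 ^ m) ^ (k + 1))) ^ k *
        ((C * R ^ (n - k)) * (2 ^ (3 ^ n) * ((k + 2) * ((k + 1) * 3 ^ m) ^ (k + 1)))) ∧
      ENNReal.ofReal (w * (1 / (2 * n)) ^ n) ≤ volume (Metric.thickening 1 (Set.range I)) := by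
  have hcp := cx_compact k m q
  obtain ⟨J, hJ⟩ := ContinuousMap.exists_restrict_eq hcp.isClosed (⟨I, hI⟩ : C((cx k m q).space, EuclideanSpace ℝ (Fin n)))
  have hJI : ∀ p : (cx k m q).space, J p = I p := fun p => DFunLike.congr_fun hJ p
  haveI : CompactSpace (cx k m q).space := isCompact_iff_compactSpace.1 hcp
  have hfin := cells_finite (Set.range I) (isCompact_range hI)
  have hW : ∀ l : List (Gr m q), Clq l → l.length ≤ k + 1 →
      ∀ p ∈ convexHull ℝ (ev m q '' {x | x ∈ l}), cell (J p) ∈ hfin.toFinset := by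
    intro l hl hlk p hp
    have hne : l ≠ [] := by
      rintro rfl
      simp at hp
    rw [← coe_im] at hp
    have hps := Geometry.SimplicialComplex.convexHull_subset_space (cl_face hl hne hlk) hp
    rw [Set.Finite.mem_toFinset]
    exact ⟨J p, ⟨⟨p, hps⟩, (hJI ⟨p, hps⟩).symm⟩, rfl⟩
  have hWne : hfin.toFinset.Nonempty := by
    let x : Gr m q := fun _ => ⟨0, hq⟩
    refine ⟨_, hW [x] ?_ (by simp) (ev m q x) (subset_convexHull ℝ _ ⟨x, by simp, rfl⟩)⟩
    intro a ha b hb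
    rw [List.mem_singleton] at ha hb
    subst ha; subst hb
    simp [adj]
  obtain ⟨F, R, h1, h2, h3⟩ := hC _ hWne
  refine ⟨hfin.toFinset.card, R, h1, ?_, ?_⟩
  · refine core hq hn (ev m q) J J.continuous ?_ hfin.toFinset hW F R h2 h3
    intro l l' hl hl' hc hc' hk hk' hd p hp p' hp'
    rw [← coe_im] at hp hp'
    have f1 := cl_face hc hl hk
    have f2 := cl_face hc' hl' hk'
    have s1 := Geometry.SimplicialComplex.convexHull_subset_space f1 hp
    have s2 := Geometry.SimplicialComplex.convexHull_subset_space f2 hp'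
    have := hT _ f1 _ f2 ?_ ⟨p, s1⟩ ⟨p', s2⟩ hp hp'
    · rwa [← hJI, ← hJI] at this
    · rw [im, im, Finset.disjoint_map, Finset.disjoint_left]
      intro a ha
      simpa using hd a (by simpa using ha)
  · apply vol_ge hn
    intro w hw
    rw [Set.Finite.mem_toFinset] at hw
    exact hw

end GG

/-- Fix `k ≥ 1`, `n ≥ 2k+1` and `ε > 0`.  There are a constant
`L(ε, k, n)`, a constant `c(n, ε) > 0`, and a sequence of finite `k`-dimensional
simplicial complexes `X i` (realized in some Euclidean spaces) such that: each vertex of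
each `X i` belongs to at most `L` faces; the number `N i` of faces of `X i` tends to
infinity; and every topological embedding of `|X i|` into `ℝⁿ` with combinatorial
thickness at least `1` has the Lebesgue measure of the open `1`-neighborhood of its image
at least `c(n, ε) * (N i)^(n/(n-k) - ε)`. -/
theorem statement9 (k n : ℕ) (hk : 1 ≤ k) (hn : 2 * k + 1 ≤ n) (ε : ℝ) (hε : 0 < ε) :
    ∃ (L : ℕ) (c : ℝ), 0 < c ∧
      ∃ (m : ℕ → ℕ)
        (X : ∀ i : ℕ, Geometry.SimplicialComplex ℝ (EuclideanSpace ℝ (Fin (m i))))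
        (N : ℕ → ℕ),
        (∀ i, (X i).faces.Finite) ∧
        (∀ i, ∀ s ∈ (X i).faces, s.card ≤ k + 1) ∧
        (∀ i, ∀ v ∈ (X i).vertices, {s | s ∈ (X i).faces ∧ v ∈ s}.ncard ≤ L) ∧
        (∀ i, (X i).faces.ncard = N i) ∧
        Tendsto N atTop atTop ∧
        (∀ i, ∀ I : (X i).space → EuclideanSpace ℝ (Fin n),
          Continuous I → Function.Injective I → HasCombThickness (X i) I 1 →
          ENNReal.ofReal (c * (N i : ℝ) ^ ((n : ℝ) / ((n : ℝ) - (k : ℝ)) - ε)) ≤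
            volume (Metric.thickening 1 (Set.range I))) := by
  have hkn : k < n := by omega
  have hn0 : 0 < n := by omega
  obtain ⟨C, hC⟩ := GG.labelling n k hk hkn.le
  obtain ⟨m0, hm0⟩ := exists_nat_ge ((k : ℝ) * ((n : ℝ) / ((n : ℝ) - k)) / ε)
  set p : ℝ := (n : ℝ) / ((n : ℝ) - k) with hp
  let m := m0 + 1
  have hm : (k : ℝ) * p ≤ m * ε := by
    rw [div_le_iff₀ hε] at hm0
    have : ((m : ℕ) : ℝ) = m0 + 1 := by simp [m]
    rw [this]; nlinarith
  let A : ℕ := ((k + 2) * (3 * 3 ^ m * (3 ^ m) ^ (k + 1))) ^ k *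
    (C * (2 ^ (3 ^ n) * ((k + 2) * ((k + 1) * 3 ^ m) ^ (k + 1))))
  let L : ℕ := 2 ^ (3 ^ m)
  let D : ℝ := max 1 ((L : ℝ) ^ (p - ε)) * (((A : ℝ) + 1) ^ p * ((C : ℝ) + 1))
  have hD : 0 < D := by
    have : (0 : ℝ) < max 1 ((L : ℝ) ^ (p - ε)) := lt_max_of_lt_left one_pos
    positivity
  refine ⟨L, (1 / (2 * n)) ^ n / D, by positivity, fun i => Fintype.card (GG.Gr m (i + 1)),
    fun i => GG.cx k m (i + 1), fun i => (GG.fc k m (i + 1)).card, fun i => GG.cx_fin _ _ _,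
    fun i => GG.cx_dim _ _ _, fun i => GG.cx_deg _ _ _, fun i => GG.cx_ncard _ _ _, ?_, ?_⟩
  · apply tendsto_atTop_mono _ tendsto_id
    intro i
    have h1 := GG.fc_ge k m (i + 1)
    have h2 : i + 1 ≤ (i + 1) ^ m := Nat.le_self_pow (by simp [m]) _
    show i ≤ _
    omega
  · intro i I hI _ hT
    obtain ⟨w, R, h1, h2, h3⟩ := GG.geom hn0 (Nat.succ_pos i) hC I hI hT
    refine le_trans (ENNReal.ofReal_le_ofReal ?_) h3
    have h4 := GG.numer (N := (GG.fc k m (i + 1)).card) (A := A) (L := L) hkn ε hε hm (Nat.succ_pos i)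
      (h2.trans (le_of_eq ?_)) h1 (GG.fc_ge k m (i + 1)) (GG.fc_le k m (i + 1))
    · rw [div_mul_eq_mul_div, div_le_iff₀ hD]
      have h5 : (0 : ℝ) ≤ (1 / (2 * n)) ^ n := by positivity
      calc _ ≤ (1 / (2 * (n : ℝ))) ^ n * _ := mul_le_mul_of_nonneg_left h4 h5
        _ = _ := by simp only [D]; ring
    · simp only [A, Nat.succ_eq_add_one]
      rw [show 3 * (i + 1) * 3 ^ m * (3 ^ m) ^ (k + 1) = (3 * 3 ^ m * (3 ^ m) ^ (k + 1)) * (i + 1) by ring,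
        ← mul_assoc (k + 2) _ (i + 1), mul_pow _ (i + 1)]
      ring
end

section
/- Let k ≥ 0 and n ≥ 2k+1, and let T > 0. Let X and Y be finite simplicial complexes of dimension at most k whose polyhedra |X| and |Y| are homotopy equivalent. Suppose there is a topological embedding J of |Y| into ℝⁿ such that the closed T-neighborhood of J(|Y|) admits a retraction onto J(|Y|). Then for every ε with 0 < ε < T there is a topological embedding I of |X| into ℝⁿ such that the closed (T−ε)-neighborhood of I(|X|) admits a retraction onto I(|X|). -/
open scoped Classical
open Metric Set Function

/-- `RetractsOnto B A` : there is a retraction from `B` onto `A`, i.e. a continuous map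
`B → A` restricting to the identity on `A`. -/
def RetractsOnto {α : Type*} [TopologicalSpace α] (B A : Set α) : Prop :=
  ∃ r : B → A, Continuous r ∧ ∀ x : B, (x : α) ∈ A → ((r x : α) = (x : α))


/-- Standard realization of an abstract complex with face set `F`. -/
def stdReal {V : Type*} [Fintype V] (F : Set (Finset V)) : Set (V → ℝ) :=
  {w | w ∈ stdSimplex ℝ V ∧ (Finset.univ.filter fun v => w v ≠ 0) ∈ F}

noncomputable def nonfaceMin {V : Type*} [Fintype V] (F : Set (Finset V)) (S : Finset V)
    (x : V → ℝ) : ℝ :=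
  if h : S.Nonempty ∧ S ∉ F then S.inf' h.1 x else 0

noncomputable def thr {V : Type*} [Fintype V] (F : Set (Finset V)) (x : V → ℝ) : ℝ :=
  (Finset.univ : Finset (Finset V)).sup' Finset.univ_nonempty fun S => nonfaceMin F S x

lemma continuous_nonfaceMin {V : Type*} [Fintype V] (F : Set (Finset V)) (S : Finset V) :
    Continuous (nonfaceMin F S) := by
  unfold nonfaceMin
  split_ifs with h
  · exact Continuous.finset_inf'_apply (f := fun v (x : V → ℝ) => x v) h.1
      (fun i _ => continuous_apply i)
  · exact continuous_const

lemma continuous_thr {V : Type*} [Fintype V] (F : Set (Finset V)) : Continuous (thr F) := by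
  unfold thr
  exact Continuous.finset_sup'_apply _ (fun S _ => continuous_nonfaceMin F S)

lemma thr_nonneg {V : Type*} [Fintype V] (F : Set (Finset V)) (x : V → ℝ) : 0 ≤ thr F x := by
  have : nonfaceMin F ∅ x ≤ thr F x :=
    Finset.le_sup' (fun S => nonfaceMin F S x) (Finset.mem_univ _)
  simpa [nonfaceMin] using this

noncomputable def cutSum {V : Type*} [Fintype V] (F : Set (Finset V)) (x : V → ℝ) : ℝ :=
  ∑ v, max 0 (x v - thr F x)

noncomputable def nretr {V : Type*} [Fintype V] (F : Set (Finset V)) (x : V → ℝ) : V → ℝ :=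
  fun v => max 0 (x v - thr F x) / cutSum F x

lemma continuous_cutSum {V : Type*} [Fintype V] (F : Set (Finset V)) : Continuous (cutSum F) := by
  unfold cutSum
  have := continuous_thr F
  fun_prop

lemma continuousOn_nretr {V : Type*} [Fintype V] (F : Set (Finset V)) :
    ContinuousOn (nretr F) {x | 0 < cutSum F x} := by
  unfold nretr
  have := continuous_thr F
  have := continuous_cutSum F
  refine continuousOn_pi.2 fun v => ContinuousOn.div (by fun_prop) (by fun_prop) ?_
  intro x hx
  exact ne_of_gt hx

lemma nretr_mem {V : Type*} [Fintype V] (F : Set (Finset V)) {x : V → ℝ} (hx : 0 < cutSum F x) :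
    nretr F x ∈ stdReal F := by
  refine ⟨⟨fun v => div_nonneg (le_max_left _ _) hx.le, ?_⟩, ?_⟩
  · simp only [nretr, ← Finset.sum_div]
    exact div_self hx.ne'
  · have hs : (Finset.univ.filter fun v => nretr F x v ≠ 0)
        = Finset.univ.filter fun v => thr F x < x v := by
      ext v
      simp only [nretr, Finset.mem_filter, Finset.mem_univ, true_and, ne_eq, div_eq_zero_iff,
        hx.ne', or_false]
      constructor
      · intro h
        by_contra h'
        exact h (max_eq_left (by linarith))
      · intro h h'
        have := le_max_right 0 (x v - thr F x)
        linarith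
    rw [hs]
    set S := Finset.univ.filter fun v => thr F x < x v with hS
    by_contra hSF
    have hne : S.Nonempty := by
      by_contra hne
      rw [Finset.not_nonempty_iff_eq_empty] at hne
      have : cutSum F x = 0 := by
        refine Finset.sum_eq_zero fun v _ => max_eq_left ?_
        have : v ∉ S := by simp [hne]
        simp only [hS, Finset.mem_filter, Finset.mem_univ, true_and, not_lt] at this
        linarith
      linarith
    have h1 : nonfaceMin F S x ≤ thr F x :=
      Finset.le_sup' (fun S => nonfaceMin F S x) (Finset.mem_univ _)
    have h2 : thr F x < nonfaceMin F S x := by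
      unfold nonfaceMin
      rw [dif_pos ⟨hne, hSF⟩, Finset.lt_inf'_iff]
      intro v hv
      simpa [hS] using hv
    linarith

lemma thr_eq_zero {V : Type*} [Fintype V] (F : Set (Finset V))
    (hF : ∀ s ∈ F, ∀ t ⊆ s, t.Nonempty → t ∈ F) {x : V → ℝ} (hx : x ∈ stdReal F) :
    thr F x = 0 := by
  refine le_antisymm ?_ (thr_nonneg F x)
  refine Finset.sup'_le _ _ fun S _ => ?_
  unfold nonfaceMin
  split_ifs with h
  · have : ∃ v ∈ S, x v = 0 := by
      by_contra! hcon
      exact h.2 (hF _ hx.2 S (fun v hv => by simpa using hcon v hv) h.1)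
    obtain ⟨v, hv, hv0⟩ := this
    exact (Finset.inf'_le _ hv).trans hv0.le
  · exact le_rfl

lemma cutSum_eq_one {V : Type*} [Fintype V] (F : Set (Finset V))
    (hF : ∀ s ∈ F, ∀ t ⊆ s, t.Nonempty → t ∈ F) {x : V → ℝ} (hx : x ∈ stdReal F) :
    cutSum F x = 1 := by
  unfold cutSum
  rw [thr_eq_zero F hF hx, ← hx.1.2]
  exact Finset.sum_congr rfl fun v _ => by rw [sub_zero]; exact max_eq_right (hx.1.1 v)

lemma nretr_eq {V : Type*} [Fintype V] (F : Set (Finset V))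
    (hF : ∀ s ∈ F, ∀ t ⊆ s, t.Nonempty → t ∈ F) {x : V → ℝ} (hx : x ∈ stdReal F) :
    nretr F x = x := by
  funext v
  unfold nretr
  rw [cutSum_eq_one F hF hx, thr_eq_zero F hF hx, div_one, sub_zero]
  exact max_eq_right (hx.1.1 v)

lemma isCompact_stdReal {V : Type*} [Fintype V] (F : Set (Finset V))
    (hF : ∀ s ∈ F, ∀ t ⊆ s, t.Nonempty → t ∈ F) : IsCompact (stdReal F) := by
  have : stdReal F = ⋃ s ∈ F, (stdSimplex ℝ V ∩ ⋂ v ∈ {v | v ∉ s}, {w : V → ℝ | w v = 0}) := by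
    ext w
    simp only [stdReal, mem_ofPred_eq, mem_iUnion, mem_inter_iff, mem_iInter, exists_prop]
    constructor
    · rintro ⟨h1, h2⟩
      exact ⟨_, h2, h1, fun v hv => by simpa using hv⟩
    · rintro ⟨s, hs, h1, h2⟩
      refine ⟨h1, hF s hs _ ?_ ?_⟩
      · intro v hv
        by_contra hvs
        simp [h2 v hvs] at hv
      · by_contra hne
        rw [Finset.not_nonempty_iff_eq_empty] at hne
        have : ∑ v, w v = 0 := Finset.sum_eq_zero fun v _ => by
          by_contra hv
          have : v ∈ (Finset.univ.filter fun v => w v ≠ 0) := by simpa using hv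
          rw [hne] at this
          simp at this
        rw [h1.2] at this
        exact one_ne_zero this
  rw [this]
  refine (Set.toFinite F).isCompact_biUnion fun s _ => (isCompact_stdSimplex ℝ V).inter_right ?_
  exact isClosed_biInter fun v _ => isClosed_eq (continuous_apply v) continuous_const

/-- Borsuk homotopy extension with values in a finite complex. -/
lemma hep {V : Type*} [Fintype V] (F : Set (Finset V))
    (hF : ∀ s ∈ F, ∀ t ⊆ s, t.Nonempty → t ∈ F)
    {N A : Type*} [MetricSpace N] [TopologicalSpace A]
    (e : A → N) (he : Topology.IsClosedEmbedding e)
    (ρ : C(N, stdReal F)) (φ : C(A, stdReal F))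
    (H : ContinuousMap.Homotopic (ρ.comp ⟨e, he.continuous⟩) φ) :
    ∃ R : C(N, stdReal F), ∀ a, R (e a) = φ a := by
  obtain ⟨H⟩ := H
  have he' : Topology.IsClosedEmbedding (Prod.map (id : unitInterval → unitInterval) e) :=
    Topology.IsClosedEmbedding.id.prodMap he
  let H' : C(unitInterval × A, V → ℝ) :=
    ⟨fun p => (H p : V → ℝ), by fun_prop⟩
  obtain ⟨G, hG⟩ := H'.exists_extension' he'
  let h : unitInterval × N → (V → ℝ) := fun p => (ρ p.2 : V → ℝ) + G p - G (0, p.2)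
  have hc : Continuous h := by fun_prop
  have hG' : ∀ t a, G (t, e a) = H (t, a) := fun t a => congrFun hG (t, a)
  have h0 : ∀ z, h (0, z) = ρ z := fun z => by simp [h]
  have hA : ∀ t a, h (t, e a) = H (t, a) := fun t a => by
    simp only [h, hG']
    rw [H.apply_zero]
    simp
  let B : Set N := Prod.snd '' {p : unitInterval × N | cutSum F (h p) ≤ 0}
  have hB : IsClosed B := isClosedMap_snd_of_compactSpace _
    (isClosed_le ((continuous_cutSum F).comp hc) continuous_const)
  have hd : Disjoint B (range e) := by
    rw [Set.disjoint_left]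
    rintro _ ⟨⟨t, z⟩, hz, rfl⟩ ⟨a, ha⟩
    simp only at ha
    subst ha
    simp only [mem_ofPred_eq, hA, cutSum_eq_one F hF (H (t, a)).2] at hz
    linarith
  obtain ⟨u, hu0, hu1, hu⟩ := exists_continuous_zero_one_of_isClosed hB he.isClosed_range hd
  let u' : N → unitInterval := fun z => ⟨u z, hu z⟩
  have hu'c : Continuous u' := by fun_prop
  have hpos : ∀ z, 0 < cutSum F (h (u' z, z)) := by
    intro z
    by_cases hz : z ∈ B
    · have : u' z = 0 := Subtype.ext (hu0 hz)
      rw [this, h0, cutSum_eq_one F hF (ρ z).2]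
      exact one_pos
    · by_contra hcon
      exact hz ⟨(u' z, z), not_lt.1 hcon, rfl⟩
  refine ⟨⟨fun z => ⟨nretr F (h (u' z, z)), nretr_mem F (hpos z)⟩, ?_⟩, ?_⟩
  · refine Continuous.subtype_mk ?_ _
    exact (continuousOn_nretr F).comp_continuous (by fun_prop) hpos
  · intro a
    apply Subtype.ext
    have : u' (e a) = 1 := Subtype.ext (hu1 ⟨a, rfl⟩)
    simp only [ContinuousMap.coe_mk, this, hA]
    rw [nretr_eq F hF (H (1, a)).2, H.apply_one]

/-- dimension estimate -/
lemma bad_dim {ι : Type*} [Fintype ι] {P : Type*} [NormedAddCommGroup P] [NormedSpace ℝ P]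
    [FiniteDimensional ℝ P] (k : ℕ) (G : (ι → ℝ) → P) (hG : ContDiff ℝ 1 G)
    (c₁ c₂ : ι → ℝ) (W₁ W₂ : Submodule ℝ (ι → ℝ)) (h₁ : Module.finrank ℝ W₁ ≤ k)
    (h₂ : Module.finrank ℝ W₂ ≤ k) (i : ι) :
    dimH {a : ι → P | ∃ x : W₁, ∃ y : W₂, (c₂ + y : ι → ℝ) i < (c₁ + x : ι → ℝ) i ∧
      G (c₁ + x) + ∑ j, (c₁ + x : ι → ℝ) j • a j = G (c₂ + y) + ∑ j, (c₂ + y : ι → ℝ) j • a j}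
    ≤ ((2 * k + (Fintype.card ι - 1) * Module.finrank ℝ P : ℕ) : ENNReal) := by
  let D := W₁ × W₂ × ({j : ι // j ≠ i} → P)
  let z : D → (ι → ℝ) := fun d => (c₁ + d.1) - (c₂ + d.2.1)
  have hz : ContDiff ℝ 1 z := by
    have h1 : ContDiff ℝ 1 (fun d : D => (d.1 : ι → ℝ)) := W₁.subtypeL.contDiff.comp contDiff_fst
    have h2 : ContDiff ℝ 1 (fun d : D => (d.2.1 : ι → ℝ)) :=
      W₂.subtypeL.contDiff.comp (contDiff_fst.comp contDiff_snd)
    exact (contDiff_const.add h1).sub (contDiff_const.add h2)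
  let g : D → P := fun d => (z d i)⁻¹ • (G (c₂ + d.2.1) - G (c₁ + d.1)
    - ∑ j : {j : ι // j ≠ i}, z d j • d.2.2 j)
  let Ψ : D → (ι → P) := fun d j => if h : j ≠ i then d.2.2 ⟨j, h⟩ else g d
  let U : Set D := {d | 0 < z d i}
  have hUc : Convex ℝ U := by
    rintro ⟨x, y, a⟩ hd ⟨x', y', a'⟩ hd' s t hs ht hst
    have : z (s • (x, y, a) + t • (x', y', a')) i = s * z (x, y, a) i + t * z (x', y', a') i := by
      have : t = 1 - s := by linarith
      subst this
      simp [z]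
      ring
    simp only [U, mem_ofPred_eq] at *
    rw [this]
    rcases hs.eq_or_lt with rfl | hs
    · have : t = 1 := by linarith
      subst this; simpa using hd'
    · have := mul_pos hs hd
      have := mul_nonneg ht hd'.le
      linarith
  have hg : ContDiffOn ℝ 1 g U := by
    have hzi : ∀ j, ContDiff ℝ 1 (fun d => z d j) := fun j => (contDiff_pi.1 hz) j
    refine ContDiffOn.smul ((hzi i).contDiffOn.inv fun d hd => ne_of_gt hd) (ContDiff.contDiffOn ?_)
    have h1 : ContDiff ℝ 1 (fun d : D => (d.1 : ι → ℝ)) := W₁.subtypeL.contDiff.comp contDiff_fst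
    have h2 : ContDiff ℝ 1 (fun d : D => (d.2.1 : ι → ℝ)) :=
      W₂.subtypeL.contDiff.comp (contDiff_fst.comp contDiff_snd)
    refine ((hG.comp (contDiff_const.add h2)).sub (hG.comp (contDiff_const.add h1))).sub ?_
    refine ContDiff.sum fun j _ => (hzi j).smul ?_
    exact (contDiff_apply ℝ P j).comp (contDiff_snd.comp contDiff_snd)
  have hΨ : ContDiffOn ℝ 1 Ψ U := by
    refine contDiffOn_pi.2 fun j => ?_
    by_cases h : j ≠ i
    · simp only [Ψ, dif_pos h]
      exact ((contDiff_apply ℝ P (⟨j, h⟩ : {j : ι // j ≠ i})).comp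
        (contDiff_snd.comp contDiff_snd)).contDiffOn
    · simp only [Ψ, dif_neg h]
      exact hg
  have hsub : {a : ι → P | ∃ x : W₁, ∃ y : W₂, (c₂ + y : ι → ℝ) i < (c₁ + x : ι → ℝ) i ∧
      G (c₁ + x) + ∑ j, (c₁ + x : ι → ℝ) j • a j = G (c₂ + y) + ∑ j, (c₂ + y : ι → ℝ) j • a j}
      ⊆ Ψ '' U := by
    rintro a ⟨x, y, hxy, hGa⟩
    let d : D := (x, y, fun j => a j)
    have hd : 0 < z d i := by simpa [z, d] using hxy
    refine ⟨d, hd, ?_⟩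
    funext j
    by_cases h : j = i
    · subst h
      simp only [Ψ, ne_eq, not_true_eq_false, dite_false, g]
      rw [inv_smul_eq_iff₀ hd.ne']
      have h3 : ∑ l, z d l • a l = G (c₂ + y) - G (c₁ + x) := by
        have : ∑ l, z d l • a l = ∑ l, (c₁ + x : ι → ℝ) l • a l - ∑ l, (c₂ + y : ι → ℝ) l • a l := by
          rw [← Finset.sum_sub_distrib]
          refine Finset.sum_congr rfl fun l _ => ?_
          rw [← sub_smul]; rfl
        rw [this, sub_eq_sub_iff_add_eq_add, add_comm, hGa, add_comm]
      have h4 : ∑ l, z d l • a l = z d j • a j + ∑ l : {l : ι // l ≠ j}, z d l • a l :=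
        Fintype.sum_eq_add_sum_subtype_ne (fun l => z d l • a l) j
      change G (c₂ + y) - G (c₁ + x) - ∑ l : {l : ι // l ≠ j}, z d l • a l = _
      rw [← h3, h4, add_sub_cancel_right]
    · simp [Ψ, h, d]
  refine (dimH_mono hsub).trans ((hΨ.dimH_image_le hUc Subset.rfl).trans ?_)
  refine (dimH_mono (subset_univ U)).trans ?_
  rw [Real.dimH_univ_eq_finrank]
  refine Nat.cast_le.2 ?_
  have : Module.finrank ℝ D = Module.finrank ℝ W₁ + (Module.finrank ℝ W₂
      + (Fintype.card ι - 1) * Module.finrank ℝ P) := by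
    simp only [D]
    rw [Module.finrank_prod, Module.finrank_prod, Module.finrank_pi_fintype]
    simp [Fintype.card_subtype_compl]
  omega

lemma general_position {ι : Type*} [Fintype ι] (k n : ℕ) (hn : 2 * k + 1 ≤ n)
    {β : Type*} [Finite β] (c : β → (ι → ℝ)) (W : β → Submodule ℝ (ι → ℝ))
    (hW : ∀ b, Module.finrank ℝ (W b) ≤ k)
    (K : Set (ι → ℝ)) (hKc : IsCompact K) (hKs : K ⊆ stdSimplex ℝ ι)
    (hK : ∀ w ∈ K, ∃ b, w - c b ∈ W b)
    (f : C(K, EuclideanSpace ℝ (Fin n))) (ε : ℝ) (hε : 0 < ε) :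
    ∃ I : C(K, EuclideanSpace ℝ (Fin n)), Injective I ∧ ∀ x, dist (I x) (f x) < ε := by
  rcases isEmpty_or_nonempty ι with hι | hι
  · exact ⟨f, injective_of_subsingleton _, fun x => by simpa using hε⟩
  let P := EuclideanSpace ℝ (Fin n)
  have : TietzeExtension P := TietzeExtension.of_homeo (EuclideanSpace.equiv (Fin n) ℝ).toHomeomorph
  obtain ⟨f', hf'⟩ := ContinuousMap.exists_restrict_eq hKc.isClosed f
  obtain ⟨G, hG, hGf, -⟩ := Continuous.exists_contDiff_approx (f := f') 1 f'.continuous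
    (ε := fun _ => ε / 2) continuous_const (fun _ => half_pos hε)
  let S : β × β × ι → Set (ι → P) := fun q =>
    {a : ι → P | ∃ x : W q.1, ∃ y : W q.2.1, (c q.2.1 + y : ι → ℝ) q.2.2 < (c q.1 + x : ι → ℝ) q.2.2 ∧
      G (c q.1 + x) + ∑ j, (c q.1 + x : ι → ℝ) j • a j
        = G (c q.2.1 + y) + ∑ j, (c q.2.1 + y : ι → ℝ) j • a j}
  have hdim : dimH (⋃ q, S q) < Module.finrank ℝ (ι → P) := by
    rw [dimH_iUnion]
    refine (iSup_le fun q : β × β × ι => bad_dim k G hG _ _ _ _ (hW q.1) (hW q.2.1) q.2.2).trans_lt ?_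
    refine Nat.cast_lt.2 ?_
    rw [Module.finrank_pi_fintype]
    have : 0 < Fintype.card ι := Fintype.card_pos
    obtain ⟨m, hm⟩ : ∃ m, Fintype.card ι = m + 1 := ⟨_, (Nat.succ_pred_eq_of_pos this).symm⟩
    simp [P, hm, add_mul]
    omega
  obtain ⟨a, ha, haε⟩ := (dense_compl_of_dimH_lt_finrank hdim).exists_dist_lt 0 (half_pos hε)
  rw [dist_comm, dist_zero_right] at haε
  let I' : (ι → ℝ) → P := fun w => G w + ∑ j, w j • a j
  have hI' : Continuous I' := by
    have := hG.continuous
    fun_prop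
  have key : ∀ w ∈ K, ∀ w' ∈ K, ∀ i, w' i < w i → I' w ≠ I' w' := by
    intro w hw w' hw' i hi heq
    obtain ⟨b, hb⟩ := hK w hw
    obtain ⟨b', hb'⟩ := hK w' hw'
    refine haε.not_ge ?_
    exfalso
    refine ha (mem_iUnion.2 ⟨(b, b', i), ⟨w - c b, hb⟩, ⟨w' - c b', hb'⟩, ?_⟩)
    simp only [add_sub_cancel]
    exact ⟨hi, heq⟩
  refine ⟨⟨fun w => I' w, by fun_prop⟩, ?_, ?_⟩
  · intro w w' h
    by_contra hne
    have : ∃ i, (w : ι → ℝ) i ≠ (w' : ι → ℝ) i := by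
      by_contra! hcon
      exact hne (Subtype.ext (funext hcon))
    obtain ⟨i, hi⟩ := this
    rcases lt_or_gt_of_ne hi with hi | hi
    · exact key _ w'.2 _ w.2 i hi h.symm
    · exact key _ w.2 _ w'.2 i hi h
  · intro w
    have h1 : dist (G w) (f w) < ε / 2 := by
      have := hGf w
      rwa [show f' w = f w from congrArg (fun h : C(K, P) => h w) hf'] at this
    have h2 : ‖∑ j, (w : ι → ℝ) j • a j‖ ≤ ‖a‖ := by
      have hws := hKs w.2
      calc ‖∑ j, (w : ι → ℝ) j • a j‖ ≤ ∑ j, (w : ι → ℝ) j * ‖a‖ := by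
            refine norm_sum_le_of_le _ fun j _ => ?_
            rw [norm_smul, Real.norm_of_nonneg (hws.1 j)]
            exact mul_le_mul_of_nonneg_left (norm_le_pi_norm a j) (hws.1 j)
        _ = ‖a‖ := by rw [← Finset.sum_mul, hws.2, one_mul]
    calc dist (I' w) (f w) ≤ dist (I' w) (G w) + dist (G w) (f w) := dist_triangle _ _ _
      _ < ε := by
        have : dist (I' w) (G w) = ‖∑ j, (w : ι → ℝ) j • a j‖ := by
          simp [I', dist_eq_norm]
        linarith

section Realization
variable {E : Type*} [NormedAddCommGroup E] [NormedSpace ℝ E]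
  (X : Geometry.SimplicialComplex ℝ E) (S : Finset E)

def facesIn : Set (Finset S) := {s | s.map (Embedding.subtype _) ∈ X.faces}

lemma facesIn_down : ∀ s ∈ facesIn X S, ∀ t ⊆ s, t.Nonempty → t ∈ facesIn X S := by
  intro s hs t hts ht
  exact X.down_closed hs (Finset.map_subset_map.2 hts) (ht.map)

noncomputable def bary (w : S → ℝ) : E := ∑ v, w v • (v : E)

lemma bary_mem_hull {w : S → ℝ} (hw : w ∈ stdReal (facesIn X S)) :
    bary S w ∈ convexHull ℝ
      (((Finset.univ.filter fun v => w v ≠ 0).map (Embedding.subtype _) : Finset E) : Set E) := by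
  unfold bary
  have h1 : ∑ v, w v • (v : E) = ∑ v ∈ Finset.univ.filter (fun v => w v ≠ 0), w v • (v : E) := by
    refine (Finset.sum_subset (Finset.filter_subset _ _) fun v _ hv => ?_).symm
    have : w v = 0 := by simpa using hv
    rw [this, zero_smul]
  rw [h1]
  refine (convex_convexHull ℝ _).sum_mem (fun v _ => hw.1.1 v) ?_ ?_
  · rw [← hw.1.2]
    refine Finset.sum_subset (Finset.filter_subset _ _) fun v _ hv => ?_
    simpa using hv
  · intro v hv
    apply subset_convexHull
    exact Finset.mem_coe.2 (Finset.mem_map_of_mem _ hv)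

lemma bary_mem {w : S → ℝ} (hw : w ∈ stdReal (facesIn X S)) : bary S w ∈ X.space :=
  X.convexHull_subset_space hw.2 (bary_mem_hull X S hw)

lemma exists_bary {s : Finset E} (hs : s ∈ X.faces) (hsS : s ⊆ S) {x : E}
    (hx : x ∈ convexHull ℝ (s : Set E)) :
    ∃ w ∈ stdReal (facesIn X S), bary S w = x ∧ ∀ v : S, (v : E) ∉ s → w v = 0 := by
  rw [Finset.mem_convexHull'] at hx
  obtain ⟨u, hu0, hu1, hux⟩ := hx
  let w : S → ℝ := fun v => if (v : E) ∈ s then u v else 0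
  have hsum : ∑ v, w v = 1 := by
    rw [← hu1]
    change ∑ v : S, (fun e : E => if e ∈ s then u e else 0) v = _
    rw [Finset.sum_coe_sort S (fun e : E => if e ∈ s then u e else 0), ← Finset.sum_filter]
    exact Finset.sum_congr (by ext e; simp; exact fun h => hsS h) fun _ _ => rfl
  have hbary : bary S w = x := by
    rw [← hux]
    unfold bary
    change ∑ v : S, (fun e : E => (if e ∈ s then u e else 0) • e) v = _
    rw [Finset.sum_coe_sort S (fun e : E => (if e ∈ s then u e else 0) • e)]
    simp only [ite_smul, zero_smul]
    rw [← Finset.sum_filter]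
    exact Finset.sum_congr (by ext e; simp; exact fun h => hsS h) fun _ _ => rfl
  refine ⟨w, ⟨⟨fun v => ?_, hsum⟩, ?_⟩, hbary, fun v hv => if_neg hv⟩
  · by_cases h : (v : E) ∈ s
    · simpa [w, h] using hu0 v h
    · simp [w, h]
  · refine X.down_closed hs ?_ ?_
    · intro e he
      simp only [Finset.mem_map, Finset.mem_filter, Finset.mem_univ, true_and] at he
      obtain ⟨v, hv, rfl⟩ := he
      by_contra h
      exact hv (if_neg h)
    · refine Finset.Nonempty.map ?_
      by_contra hne
      rw [Finset.not_nonempty_iff_eq_empty] at hne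
      have : ∑ v, w v = 0 := Finset.sum_eq_zero fun v _ => by
        by_contra hv
        have : v ∈ (Finset.univ.filter fun v => w v ≠ 0) := by simpa using hv
        rw [hne] at this
        simp at this
      rw [hsum] at this
      exact one_ne_zero this

lemma bary_unique {s : Finset E} (hs : s ∈ X.faces) (hsS : s ⊆ S) {w w' : S → ℝ}
    (hw : ∑ v, w v = 1) (hw' : ∑ v, w' v = 1) (h : ∀ v : S, (v : E) ∉ s → w v = 0)
    (h' : ∀ v : S, (v : E) ∉ s → w' v = 0) (hb : bary S w = bary S w') : w = w' := by
  let d : E → ℝ := fun e => if he : e ∈ S then w ⟨e, he⟩ - w' ⟨e, he⟩ else 0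
  have hdv : ∀ v : S, d v = w v - w' v := fun v => by simp [d]
  have hd0 : ∀ e ∈ S, e ∉ s → d e = 0 := fun e he hes => by
    have := hdv ⟨e, he⟩
    rw [h _ hes, h' _ hes, sub_zero] at this
    exact this
  have h1 : ∑ e : s, d e = 0 := by
    rw [Finset.sum_coe_sort s d, Finset.sum_subset hsS hd0, ← Finset.sum_coe_sort S d]
    simp only [hdv, Finset.sum_sub_distrib, hw, hw', sub_self]
  have h2 : ∑ e : s, d e • (e : E) = 0 := by
    rw [Finset.sum_coe_sort s (fun e => d e • e), Finset.sum_subset hsS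
      (fun e he hes => by rw [hd0 e he hes, zero_smul]), ← Finset.sum_coe_sort S (fun e => d e • e)]
    simp only [hdv, sub_smul, Finset.sum_sub_distrib]
    exact sub_eq_zero.2 hb
  have h3 := affineIndependent_iff.1 (X.indep hs) Finset.univ (fun e => d e) h1 h2
  funext v
  by_cases hv : (v : E) ∈ s
  · have := h3 ⟨v, hv⟩ (Finset.mem_univ _)
    simp only [hdv] at this
    linarith
  · rw [h v hv, h' v hv]

lemma bary_injOn (hS : ∀ s ∈ X.faces, s ⊆ S) : InjOn (bary S) (stdReal (facesIn X S)) := by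
  intro w hw w' hw' hb
  set s := (Finset.univ.filter fun v => w v ≠ 0).map (Embedding.subtype (· ∈ S)) with hs
  set t := (Finset.univ.filter fun v => w' v ≠ 0).map (Embedding.subtype (· ∈ S)) with ht
  have hsF : s ∈ X.faces := hw.2
  have htF : t ∈ X.faces := hw'.2
  have hxs := bary_mem_hull X S hw
  have hxt := bary_mem_hull X S hw'
  rw [← hb] at hxt
  have hx : bary S w ∈ convexHull ℝ ((s ∩ t : Finset E) : Set E) := by
    rw [Finset.coe_inter]
    exact X.inter_subset_convexHull hsF htF ⟨hxs, hxt⟩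
  have hne : (s ∩ t).Nonempty := by
    rw [← Finset.coe_nonempty]
    exact convexHull_nonempty_iff.1 ⟨_, hx⟩
  have hstF : s ∩ t ∈ X.faces := X.down_closed hsF Finset.inter_subset_left hne
  obtain ⟨u, hu, hux, hu0⟩ := exists_bary X S hstF (hS _ hstF) hx
  have hws : ∀ v : S, (v : E) ∉ s → w v = 0 := fun v hv => by
    by_contra h
    exact hv (Finset.mem_map_of_mem (Embedding.subtype (· ∈ S)) (by simpa using h))
  have hwt : ∀ v : S, (v : E) ∉ t → w' v = 0 := fun v hv => by
    by_contra h
    exact hv (Finset.mem_map_of_mem (Embedding.subtype (· ∈ S)) (by simpa using h))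
  have e1 : w = u := bary_unique X S hsF (hS _ hsF) hw.1.2 hu.1.2 hws
    (fun v hv => hu0 v fun h => hv (Finset.mem_inter.1 h).1) hux.symm
  have e2 : w' = u := bary_unique X S htF (hS _ htF) hw'.1.2 hu.1.2 hwt
    (fun v hv => hu0 v fun h => hv (Finset.mem_inter.1 h).2) (hb ▸ hux.symm)
  rw [e1, e2]

lemma exists_homeo (hS : ∀ s ∈ X.faces, s ⊆ S) :
    Nonempty (stdReal (facesIn X S) ≃ₜ X.space) := by
  have : CompactSpace (stdReal (facesIn X S)) :=
    isCompact_iff_compactSpace.1 (isCompact_stdReal _ (facesIn_down X S))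
  let p : stdReal (facesIn X S) → X.space := fun w => ⟨bary S w, bary_mem X S w.2⟩
  have hp : Continuous p := by
    refine Continuous.subtype_mk ?_ _
    unfold bary
    exact continuous_finsetSum _ fun v _ =>
      ((continuous_apply v).comp continuous_subtype_val).smul continuous_const
  have hb : Bijective p := by
    constructor
    · intro w w' h
      exact Subtype.ext (bary_injOn X S hS w.2 w'.2 (congrArg Subtype.val h))
    · rintro ⟨x, hx⟩
      obtain ⟨s, hs, hxs⟩ := X.mem_space_iff.1 hx
      obtain ⟨w, hw, hwx, -⟩ := exists_bary X S hs (hS s hs) hxs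
      exact ⟨⟨w, hw⟩, Subtype.ext hwx⟩
  exact ⟨Continuous.homeoOfEquivCompactToT2 (f := Equiv.ofBijective p hb) hp⟩

end Realization

lemma approx_embedding {V : Type*} [Fintype V] (F : Set (Finset V))
    (hF : ∀ s ∈ F, ∀ t ⊆ s, t.Nonempty → t ∈ F) (hne : ∀ s ∈ F, s.Nonempty)
    (k n : ℕ) (hn : 2 * k + 1 ≤ n) (hdim : ∀ s ∈ F, s.card ≤ k + 1)
    (f : C(stdReal F, EuclideanSpace ℝ (Fin n))) (ε : ℝ) (hε : 0 < ε) :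
    ∃ I : C(stdReal F, EuclideanSpace ℝ (Fin n)), Injective I ∧ ∀ x, dist (I x) (f x) < ε := by
  have hv : ∀ b : F, ∃ v, v ∈ (b : Finset V) := fun b => hne b b.2
  choose v0 hv0 using hv
  let pt : V → (V → ℝ) := fun v => Pi.single v 1
  refine general_position k n hn (β := F) (fun b => pt (v0 b))
    (fun b => vectorSpan ℝ (((b : Finset V).image pt : Finset (V → ℝ)) : Set (V → ℝ))) ?_ (stdReal F)
    (isCompact_stdReal F hF) (fun w hw => hw.1) ?_ f ε hε
  · intro b
    have h1 := hdim b b.2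
    have h2 := Finset.card_pos.2 (hne b b.2)
    refine (finrank_vectorSpan_image_finset_le ℝ pt (b : Finset V)
      (n := (b : Finset V).card - 1) (by omega)).trans (by omega)
  · intro w hw
    refine ⟨⟨_, hw.2⟩, ?_⟩
    set b : F := ⟨_, hw.2⟩ with hb
    have h1 : w ∈ convexHull ℝ (((b : Finset V).image pt : Finset (V → ℝ)) : Set (V → ℝ)) := by
      have : w = ∑ v ∈ (b : Finset V), w v • pt v := by
        have h : w = ∑ v, w v • pt v := by
          funext u
          simp [pt, Finset.sum_apply, Pi.single_apply]
        conv_lhs => rw [h]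
        refine (Finset.sum_subset (Finset.subset_univ _) fun v _ hv => ?_).symm
        have : w v = 0 := by simpa [hb] using hv
        rw [this, zero_smul]
      rw [this]
      refine (convex_convexHull ℝ _).sum_mem (fun v _ => hw.1.1 v) ?_ ?_
      · rw [← hw.1.2]
        refine Finset.sum_subset (Finset.subset_univ _) fun v _ hv => ?_
        simpa [hb] using hv
      · intro v hv
        apply subset_convexHull
        exact Finset.mem_coe.2 (Finset.mem_image_of_mem _ hv)
    have h2 := convexHull_subset_affineSpan _ h1
    have h3 : pt (v0 b) ∈ affineSpan ℝ (((b : Finset V).image pt : Finset (V → ℝ)) : Set (V → ℝ)) :=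
      subset_affineSpan _ _ (Finset.mem_coe.2 (Finset.mem_image_of_mem _ (hv0 b)))
    have := AffineSubspace.vsub_mem_direction h2 h3
    rwa [direction_affineSpan] at this

lemma isCompact_space {E : Type*} [NormedAddCommGroup E] [NormedSpace ℝ E]
    (X : Geometry.SimplicialComplex ℝ E) (h : X.faces.Finite) : IsCompact X.space :=
  h.isCompact_biUnion fun s _ => s.finite_toSet.isCompact_convexHull ℝ

/-- Let `k ≥ 0`, `n ≥ 2k+1` and `T > 0`.  Let `X` and `Y` be finite
simplicial complexes of dimension at most `k` with homotopy equivalent polyhedra.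
If `|Y|` embeds into `ℝⁿ` with retraction thickness at least `T` (the closed
`T`-neighborhood of the image retracts onto the image), then for every `0 < ε < T`
the polyhedron `|X|` embeds into `ℝⁿ` with retraction thickness at least `T - ε`. -/
theorem statement10 (k n : ℕ) (hn : 2 * k + 1 ≤ n) (T : ℝ) (hT : 0 < T)
    {E E' : Type*} [NormedAddCommGroup E] [NormedSpace ℝ E]
    [NormedAddCommGroup E'] [NormedSpace ℝ E']
    (X : Geometry.SimplicialComplex ℝ E) (Y : Geometry.SimplicialComplex ℝ E')
    (hXfin : X.faces.Finite) (hYfin : Y.faces.Finite)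
    (hXdim : ∀ s ∈ X.faces, s.card ≤ k + 1) (hYdim : ∀ s ∈ Y.faces, s.card ≤ k + 1)
    (hhe : Nonempty (ContinuousMap.HomotopyEquiv X.space Y.space))
    (J : Y.space → EuclideanSpace ℝ (Fin n))
    (hJc : Continuous J) (hJinj : Function.Injective J)
    (hJret : RetractsOnto (Metric.cthickening T (Set.range J)) (Set.range J))
    (ε : ℝ) (hε : 0 < ε) (hεT : ε < T) :
    ∃ I : X.space → EuclideanSpace ℝ (Fin n),
      Continuous I ∧ Function.Injective I ∧
      RetractsOnto (Metric.cthickening (T - ε) (Set.range I)) (Set.range I) := by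
  obtain ⟨h⟩ := hhe
  obtain ⟨r, hrc, hr⟩ := hJret
  let S : Finset E := hXfin.toFinset.biUnion id
  have hS : ∀ s ∈ X.faces, s ⊆ S := fun s hs =>
    Finset.subset_biUnion_of_mem id (hXfin.mem_toFinset.2 hs)
  let F := facesIn X S
  have hF : ∀ s ∈ F, ∀ t ⊆ s, t.Nonempty → t ∈ F := facesIn_down X S
  obtain ⟨φ⟩ := exists_homeo X S hS
  have : CompactSpace X.space := isCompact_iff_compactSpace.1 (isCompact_space X hXfin)
  have : CompactSpace Y.space := isCompact_iff_compactSpace.1 (isCompact_space Y hYfin)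
  let jh : Y.space ≃ₜ range J := (hJc.isClosedEmbedding hJinj).isEmbedding.toHomeomorph
  -- the approximating embedding
  obtain ⟨I', hI'inj, hI'd⟩ := approx_embedding F hF
    (fun s hs => Finset.map_nonempty.1 (X.nonempty_of_mem_faces hs)) k n hn
    (fun s hs => by simpa using hXdim _ hs)
    ⟨fun w => J (h.toFun (φ w)), by fun_prop⟩ ε hε
  let I : X.space → EuclideanSpace ℝ (Fin n) := fun x => I' (φ.symm x)
  have hIc : Continuous I := by fun_prop
  have hIinj : Injective I := hI'inj.comp φ.symm.injective
  have hId : ∀ x, dist (I x) (J (h.toFun x)) < ε := fun x => by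
    have := hI'd (φ.symm x)
    simpa [I] using this
  refine ⟨I, hIc, hIinj, ?_⟩
  let N := cthickening (T - ε) (range I)
  have hIJ : range I ⊆ cthickening ε (range J) := by
    rintro _ ⟨x, rfl⟩
    exact mem_cthickening_of_dist_le _ _ _ _ ⟨_, rfl⟩ (hId x).le
  have hN : ∀ z ∈ N, z ∈ cthickening T (range J) := by
    intro z hz
    have h1 := cthickening_subset_of_subset (T - ε) hIJ hz
    have h2 := cthickening_cthickening_subset (by linarith) hε.le _ h1
    rwa [sub_add_cancel] at h2
  let q : C(cthickening T (range J), X.space) :=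
    ⟨fun z => h.invFun (jh.symm (r z)), by fun_prop⟩
  let ρ : C(N, stdReal F) := ⟨fun z => φ.symm (q ⟨z, hN z z.2⟩), by fun_prop⟩
  let e : X.space → N := fun x => ⟨I x, self_subset_cthickening _ ⟨x, rfl⟩⟩
  have hec : Continuous e := by fun_prop
  have he : Topology.IsClosedEmbedding e :=
    hec.isClosedEmbedding fun x y hxy => hIinj (congrArg Subtype.val hxy)
  -- straight line homotopy
  have hseg : ∀ (t : unitInterval) (x : X.space),
      J (h.toFun x) + (t : ℝ) • (I x - J (h.toFun x)) ∈ cthickening T (range J) := by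
    intro t x
    refine mem_cthickening_of_dist_le _ (J (h.toFun x)) _ _ ⟨_, rfl⟩ ?_
    rw [dist_eq_norm, add_sub_cancel_left, norm_smul, Real.norm_of_nonneg t.2.1, ← dist_eq_norm]
    have h1 := hId x
    have h2 := t.2.2
    have h3 := t.2.1
    have h4 := dist_nonneg (x := I x) (y := J (h.toFun x))
    nlinarith
  have H1 : ContinuousMap.Homotopic (h.invFun.comp h.toFun)
      (q.comp ⟨fun x => ⟨I x, hN _ (e x).2⟩, by fun_prop⟩) := by
    refine ⟨⟨⟨fun p => q ⟨_, hseg p.1 p.2⟩, by fun_prop⟩, ?_, ?_⟩⟩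
    · intro x
      have hm : J (h.toFun x) ∈ cthickening T (range J) :=
        self_subset_cthickening _ ⟨_, rfl⟩
      have h1 : (⟨_, hseg 0 x⟩ : cthickening T (range J)) = ⟨J (h.toFun x), hm⟩ := by
        apply Subtype.ext; simp
      have h2 : r ⟨J (h.toFun x), hm⟩ = jh (h.toFun x) :=
        Subtype.ext (hr ⟨J (h.toFun x), hm⟩ ⟨_, rfl⟩)
      change q ⟨_, hseg 0 x⟩ = _
      rw [h1]
      change h.invFun (jh.symm (r ⟨J (h.toFun x), hm⟩)) = _
      rw [h2, Homeomorph.symm_apply_apply]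
      rfl
    · intro x
      change q ⟨_, hseg 1 x⟩ = _
      have h1 : (⟨_, hseg 1 x⟩ : cthickening T (range J)) = ⟨I x, hN _ (e x).2⟩ := by
        apply Subtype.ext; simp
      rw [h1]
      rfl
  have H2 : ContinuousMap.Homotopic
      (q.comp ⟨fun x => ⟨I x, hN _ (e x).2⟩, by fun_prop⟩) (ContinuousMap.id X.space) :=
    H1.symm.trans h.left_inv
  have H3 : ContinuousMap.Homotopic (ρ.comp ⟨e, he.continuous⟩)
      (φ.symm : C(X.space, stdReal F)) :=
    (ContinuousMap.Homotopic.refl (φ.symm : C(X.space, stdReal F))).comp H2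
  obtain ⟨R, hR⟩ := hep F hF e he ρ _ H3
  refine ⟨fun z => ⟨I (φ (R z)), ⟨_, rfl⟩⟩, by fun_prop, ?_⟩
  rintro ⟨z, hz⟩ ⟨x, rfl⟩
  have := hR x
  change I (φ (R (e x))) = I x
  rw [this]
  simp
end
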